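/- arXiv:2101.12652 — 4 statements merged into one kernel-verified Lean document; each statement's English description precedes it below -/
import Mathlib

section
/- Let N ≥ 2 and k ∈ ℕ. For every compact set K ⊆ ℝ^{N+1} and every η > 0 there exist a bounded open set Ω ⊆ ℝ^{N+1} with smooth boundary and a positive smooth function u : Ω → ℝ, extending C² to the closure, such that: (i) Ω is star-shaped with respect to an interior point; (ii) the Lebesgue measure of K ∩ (𝒞 Δ Ω) is less than η, where 𝒞 = {(x,y) ∈ ℝ × ℝ^N : |y|² < N} and Δ denotes symmetric difference; (iii) at every boundary point p ∈ ∂Ω the gradient ∇u(p) ≠ 0, the mixed second derivatives ∂²u/∂y_i∂y_j(p) vanish for i ≠ j, and the mean curvature of ∂Ω at p, given by K_m = −(1/(N·|∇u|³))·[Σ_{j=1}^N (u_x² u_{y_jy_j} − 2 u_x u_{y_j} u_{x y_j} + u_{y_j}² u_{xx}) + Σ_{j=1}^N u_{y_j}² Σ_{ℓ≠j} u_{y_ℓ y_ℓ}], is strictly positive; (iv) u solves the torsion problem −Δu = 1 in Ω with u = 0 on ∂Ω; (v) u has at least k nondegenerate local maximum points in Ω (points where ∇u = 0 and the Hessian of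 u is negative definite). -/
open MeasureTheory Set Filter Topology

noncomputable section

/-- Points of `ℝ^{N+1}` written `(x, y)` with `x ∈ ℝ`, `y ∈ ℝ^N`. -/
abbrev Pt (N : ℕ) := ℝ × (Fin N → ℝ)

/-- Second directional derivative of `u` at `p`: first along `w`, then along `v`. -/
def D2 {N : ℕ} (u : Pt N → ℝ) (v w : Pt N) (p : Pt N) : ℝ :=
  fderiv ℝ (fun q => fderiv ℝ u q w) p v

/-- Directional derivative in the `x` direction. -/
def Dx {N : ℕ} (u : Pt N → ℝ) (p : Pt N) : ℝ := fderiv ℝ u p (1, 0)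

/-- Directional derivative in the `y_j` direction. -/
def Dy {N : ℕ} (u : Pt N → ℝ) (j : Fin N) (p : Pt N) : ℝ := fderiv ℝ u p (0, Pi.single j 1)

/-- The Laplacian of `u` at `p`. -/
def lap {N : ℕ} (u : Pt N → ℝ) (p : Pt N) : ℝ :=
  D2 u (1, 0) (1, 0) p + ∑ j : Fin N, D2 u (0, Pi.single j 1) (0, Pi.single j 1) p

/-- Squared Euclidean norm of the gradient of `u` at `p`. -/
def gradSq {N : ℕ} (u : Pt N → ℝ) (p : Pt N) : ℝ :=
  (Dx u p) ^ 2 + ∑ j : Fin N, (Dy u j p) ^ 2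

/-- The mean curvature of the level hypersurface of `u` through `p`, with respect to the
inner normal `−∇u/|∇u|` (valid when the mixed `y`-derivatives vanish). -/
def Km (N : ℕ) (u : Pt N → ℝ) (p : Pt N) : ℝ :=
  -(1 / (N * Real.sqrt (gradSq u p) ^ 3)) *
    ((∑ j : Fin N,
        ((Dx u p) ^ 2 * D2 u (0, Pi.single j 1) (0, Pi.single j 1) p
          - 2 * Dx u p * Dy u j p * D2 u (1, 0) (0, Pi.single j 1) p
          + (Dy u j p) ^ 2 * D2 u (1, 0) (1, 0) p))
      + ∑ j : Fin N, (Dy u j p) ^ 2 *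
          ∑ l ∈ Finset.univ.erase j, D2 u (0, Pi.single l 1) (0, Pi.single l 1) p)

/-- `Ω` has smooth boundary. -/
def SmoothBoundary {N : ℕ} (Ω : Set (Pt N)) : Prop :=
  ∀ p ∈ frontier Ω, ∃ F : Pt N → ℝ,
    ContDiffAt ℝ (⊤ : ℕ∞) F p ∧ fderiv ℝ F p ≠ 0 ∧ ∀ᶠ q in nhds p, (q ∈ Ω ↔ F q < 0)

/-- On the nonnegative reals a lower power is dominated by a small multiple of a higher one. -/
lemma exists_pow_le_mul_pow_add {i n : ℕ} (hin : i < n) {τ : ℝ} (hτ : 0 < τ) :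
    ∃ C, ∀ r : ℝ, 0 ≤ r → r ^ i ≤ τ * r ^ n + C := by
  refine ⟨(max 1 (1 / τ)) ^ i, fun r hr => ?_⟩
  set M := max 1 (1 / τ)
  rcases le_total r M with h | h
  · have := pow_le_pow_left₀ hr h i
    have : 0 ≤ τ * r ^ n := by positivity
    linarith
  · have h1 : 1 ≤ r := le_trans (le_max_left _ _) h
    have h2 : 1 / τ ≤ r := le_trans (le_max_right _ _) h
    have h3 : 1 ≤ τ * r := by rwa [div_le_iff₀' hτ] at h2
    have h4 : r ^ (i + 1) ≤ r ^ n := pow_le_pow_right₀ h1 hin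
    have h5 : r ^ i ≤ τ * r ^ (i + 1) := by
      rw [pow_succ]
      nlinarith [pow_nonneg hr i]
    have h6 : 0 ≤ M ^ i := by positivity
    nlinarith

lemma norm_pow_sub_pow_le_mul {A : Type*} [NormedField A] {a b : A} {M R : ℝ}
    (ha : ‖a‖ ≤ M) (hb : ‖b‖ ≤ M) (hab : ‖a - b‖ ≤ R) (n : ℕ) :
    ‖a ^ n - b ^ n‖ ≤ n * R * M ^ (n - 1) := by
  have hM : 0 ≤ M := (norm_nonneg a).trans ha
  induction n with
  | zero => simp
  | succ n ih =>
    have e : a ^ (n + 1) - b ^ (n + 1) = a * (a ^ n - b ^ n) + (a - b) * b ^ n := by ring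
    have h1 : ‖a‖ * ‖a ^ n - b ^ n‖ ≤ M * (n * R * M ^ (n - 1)) := by gcongr
    have h2 : ‖a - b‖ * ‖b ^ n‖ ≤ R * M ^ n := by
      rw [norm_pow]
      have := (norm_nonneg _).trans hab
      gcongr
    have h3 : M * (n * R * M ^ (n - 1)) = n * R * M ^ n := by
      cases n with
      | zero => simp
      | succ k => simp [pow_succ]; ring
    rw [e]
    refine (norm_add_le _ _).trans ?_
    rw [norm_mul, norm_mul]
    push_cast
    linarith

lemma exists_norm_eval_le_mul_pow_add (Q : Polynomial ℂ) {n : ℕ} (hQ : Q.degree < n) {τ : ℝ}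
    (hτ : 0 < τ) : ∃ C, ∀ z : ℂ, ‖Q.eval z‖ ≤ τ * ‖z‖ ^ n + C := by
  have hd : 0 < τ / ((∑ i ∈ Finset.range n, ‖Q.coeff i‖) + 1) := by positivity
  have h : ∀ i : ℕ, ∃ C, i < n → ∀ r : ℝ, 0 ≤ r →
      r ^ i ≤ τ / ((∑ i ∈ Finset.range n, ‖Q.coeff i‖) + 1) * r ^ n + C := fun i => by
    by_cases hi : i < n
    · obtain ⟨C, hC⟩ := exists_pow_le_mul_pow_add hi hd
      exact ⟨C, fun _ => hC⟩
    · exact ⟨0, fun h => absurd h hi⟩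
  choose C hC using h
  refine ⟨∑ i ∈ Finset.range n, ‖Q.coeff i‖ * C i, fun z => ?_⟩
  have hs : Q.eval z = ∑ i ∈ Finset.range n, Q.coeff i * z ^ i := by
    by_cases hQ0 : Q = 0
    · simp [hQ0]
    · exact Polynomial.eval_eq_sum_range' ((Polynomial.natDegree_lt_iff_degree_lt hQ0).2 hQ) z
  rw [hs]
  set S := ∑ i ∈ Finset.range n, ‖Q.coeff i‖ with hS
  have hS0 : 0 ≤ S := by positivity
  calc ‖∑ i ∈ Finset.range n, Q.coeff i * z ^ i‖
      ≤ ∑ i ∈ Finset.range n, ‖Q.coeff i * z ^ i‖ := norm_sum_le _ _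
    _ ≤ ∑ i ∈ Finset.range n, ‖Q.coeff i‖ * (τ / (S + 1) * ‖z‖ ^ n + C i) := by
        refine Finset.sum_le_sum fun i hi => ?_
        rw [norm_mul, norm_pow]
        exact mul_le_mul_of_nonneg_left (hC i (Finset.mem_range.1 hi) _ (norm_nonneg _))
          (norm_nonneg _)
    _ = S / (S + 1) * (τ * ‖z‖ ^ n) + ∑ i ∈ Finset.range n, ‖Q.coeff i‖ * C i := by
        simp only [mul_add, Finset.sum_add_distrib, ← Finset.sum_mul, ← hS]
        ring
    _ ≤ _ := by
        have : S / (S + 1) ≤ 1 := by rw [div_le_one (by positivity)]; linarith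
        have h2 : 0 ≤ τ * ‖z‖ ^ n := by positivity
        nlinarith

lemma exists_norm_pow_le_re_pow_add (m : ℕ) (hm : 0 < m) {R : ℝ} (hR : 0 ≤ R) {τ : ℝ}
    (hτ : 0 < τ) :
    ∃ C, ∀ z : ℂ, |z.im| ≤ R → ‖z‖ ^ (2 * m) ≤ (z ^ (2 * m)).re + τ * ‖z‖ ^ (2 * m) + C := by
  set n := 2 * m with hn
  obtain ⟨C, hC⟩ := exists_pow_le_mul_pow_add (i := n - 1) (n := n) (by omega)
    (τ := τ / (2 * n * R + 1)) (by positivity)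
  refine ⟨2 * n * R * C, fun z hz => ?_⟩
  have hx : ‖(z.re : ℂ)‖ ≤ ‖z‖ := by simpa using Complex.abs_re_le_norm z
  have hzx : ‖z - z.re‖ ≤ R := by
    have : z - z.re = z.im * Complex.I := by
      apply Complex.ext <;> simp
    rw [this]; simpa using hz
  have h1 := norm_pow_sub_pow_le_mul le_rfl hx hzx n
  have h2 : ‖‖z‖ ^ n - ‖(z.re : ℂ)‖ ^ n‖ ≤ n * R * ‖z‖ ^ (n - 1) :=
    norm_pow_sub_pow_le_mul (by simp) (by simpa using hx)
      ((abs_norm_sub_norm_le z z.re).trans hzx) n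
  have h3 := (Complex.abs_re_le_norm _).trans h1
  have h4 : ((z.re : ℂ) ^ n).re = ‖(z.re : ℂ)‖ ^ n := by
    rw [← Complex.ofReal_pow, Complex.ofReal_re, Complex.norm_real, Real.norm_eq_abs, hn,
      Even.pow_abs (even_two_mul m)]
  rw [Complex.sub_re, h4] at h3
  rw [Real.norm_eq_abs] at h2
  have h5 := hC ‖z‖ (norm_nonneg z)
  have h6 := (abs_le.1 h3).1
  have h7 := (abs_le.1 h2).2
  have h8 : 2 * n * R * ‖z‖ ^ (n - 1) ≤ 2 * n * R * (τ / (2 * n * R + 1) * ‖z‖ ^ n + C) := by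
    gcongr
  have h9 : 2 * n * R * (τ / (2 * n * R + 1) * ‖z‖ ^ n) ≤ τ * ‖z‖ ^ n := by
    have e : 2 * n * R * (τ / (2 * n * R + 1) * ‖z‖ ^ n)
        = (2 * n * R / (2 * n * R + 1)) * (τ * ‖z‖ ^ n) := by ring
    rw [e]
    have : 2 * n * R / (2 * n * R + 1) ≤ 1 := by rw [div_le_one (by positivity)]; linarith
    exact mul_le_of_le_one_left (by positivity) this
  linarith

/-- On a horizontal strip, the real part of a monic polynomial of even degree dominates every
polynomial of smaller degree. -/
lemma exists_norm_eval_le_mul_re_eval_add {G Q : Polynomial ℂ} {m : ℕ} (hm : 0 < m) (hG : G.Monic)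
    (hd : G.natDegree = 2 * m) (hQ : Q.degree < ((2 * m : ℕ) : WithBot ℕ)) {R : ℝ} (hR : 0 ≤ R) {τ : ℝ}
    (hτ : 0 < τ) :
    ∃ C, ∀ z : ℂ, |z.im| ≤ R → ‖Q.eval z‖ ≤ τ * (G.eval z).re + C := by
  obtain ⟨C₁, h₁⟩ := exists_norm_eval_le_mul_pow_add Q hQ (half_pos hτ)
  obtain ⟨C₂, h₂⟩ := exists_norm_pow_le_re_pow_add m hm hR (τ := 1 / 4) (by norm_num)
  have hQ' : (G - Polynomial.X ^ (2 * m)).degree < ((2 * m : ℕ) : WithBot ℕ) := by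
    have hdeg : G.degree = ((2 * m : ℕ) : WithBot ℕ) := by
      rw [Polynomial.degree_eq_natDegree hG.ne_zero, hd]
    refine (Polynomial.degree_sub_lt_left ?_ hG.ne_zero ?_).trans_eq hdeg
    · rw [hdeg, Polynomial.degree_X_pow]
    · rw [hG.leadingCoeff, Polynomial.leadingCoeff_X_pow]
  obtain ⟨C₃, h₃⟩ := exists_norm_eval_le_mul_pow_add _ hQ' (τ := 1 / 4) (by norm_num)
  refine ⟨C₁ + τ * (C₂ + C₃), fun z hz => ?_⟩
  have a₁ := h₁ z
  have a₂ := h₂ z hz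
  have a₃ := (Complex.abs_re_le_norm _).trans (h₃ z)
  simp only [Polynomial.eval_sub, Polynomial.eval_pow, Polynomial.eval_X, Complex.sub_re] at a₃
  have a₄ := (abs_le.1 a₃).1
  have : ‖z‖ ^ (2 * m) / 2 ≤ (G.eval z).re + (C₂ + C₃) := by linarith
  nlinarith

lemma exists_re_two_mul_sub_mul_derivative_le {G : Polynomial ℂ} {m : ℕ} (hm : 2 ≤ m)
    (hG : G.Monic) (hd : G.natDegree = 2 * m) {R : ℝ} (hR : 0 ≤ R) :
    ∃ C, ∀ z : ℂ, |z.im| ≤ R → (2 * G.eval z - z * G.derivative.eval z).re ≤ C := by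
  set Q : Polynomial ℂ := Polynomial.C (2 * m : ℂ) * G - Polynomial.X * G.derivative with hQdef
  have hQ : Q.degree < ((2 * m : ℕ) : WithBot ℕ) := by
    rw [Polynomial.degree_lt_iff_coeff_zero]
    intro i hi
    rw [hQdef, Polynomial.coeff_sub, Polynomial.coeff_C_mul]
    obtain ⟨j, rfl⟩ : ∃ j, i = j + 1 := ⟨i - 1, by omega⟩
    rw [Polynomial.coeff_X_mul, Polynomial.coeff_derivative]
    rcases hi.eq_or_lt with h | h
    · have : (j : ℂ) + 1 = 2 * m := by exact_mod_cast h.symm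
      rw [this]; ring
    · rw [Polynomial.coeff_eq_zero_of_natDegree_lt (by omega)]; ring
  obtain ⟨C₁, h₁⟩ := exists_norm_eval_le_mul_re_eval_add (by omega) hG hd hQ hR one_pos
  obtain ⟨C₂, h₂⟩ := exists_norm_eval_le_mul_re_eval_add (Q := 0) (by omega) hG hd
    (by rw [Polynomial.degree_zero]; exact WithBot.bot_lt_coe _) hR one_pos
  refine ⟨C₁ + (2 * m - 3) * C₂, fun z hz => ?_⟩
  have a₁ := (Complex.re_le_norm _).trans (h₁ z hz)
  have a₂ := h₂ z hz
  simp only [Polynomial.eval_zero, norm_zero] at a₂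
  have e : Q.eval z = (2 * m : ℝ) * G.eval z - z * G.derivative.eval z := by
    simp [hQdef]
  rw [e, Complex.sub_re, Complex.re_ofReal_mul] at a₁
  have e2 : (2 * G.eval z - z * G.derivative.eval z).re
      = 2 * (G.eval z).re - (z * G.derivative.eval z).re := by simp
  rw [e2]
  have hm' : (2 : ℝ) ≤ m := by exact_mod_cast hm
  nlinarith

/-- The continuous linear map `(x, y) ↦ x + i y_j`. -/
def complexCoord {N : ℕ} (j : Fin N) : Pt N →L[ℝ] ℂ :=
  Complex.ofRealCLM.comp (ContinuousLinearMap.fst ℝ ℝ (Fin N → ℝ)) +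
    Complex.I • (Complex.ofRealCLM.comp
      ((ContinuousLinearMap.proj j).comp (ContinuousLinearMap.snd ℝ ℝ (Fin N → ℝ))))

@[simp] lemma complexCoord_re {N : ℕ} (j : Fin N) (p : Pt N) : (complexCoord j p).re = p.1 := by
  simp [complexCoord]

@[simp] lemma complexCoord_im {N : ℕ} (j : Fin N) (p : Pt N) : (complexCoord j p).im = p.2 j := by
  simp [complexCoord]

/-- A quadratic torsion function of the cylinder perturbed by the harmonic function
`∑ⱼ Re G(x + i yⱼ)`. -/
def torsionFn (N : ℕ) (G : Polynomial ℂ) (ε : ℝ) (p : Pt N) : ℝ :=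
  (1 - (∑ j, p.2 j ^ 2) / N) / 2 - ε * ∑ j, (G.eval (complexCoord j p)).re

section torsionFn

variable {N : ℕ} (G : Polynomial ℂ) (ε : ℝ)

lemma hasFDerivAt_re_eval_mul (c : ℂ) (j : Fin N) (p : Pt N) :
    HasFDerivAt (fun q : Pt N => (G.eval (complexCoord j q) * c).re)
      (Complex.reCLM.comp ((G.derivative.eval (complexCoord j p) * c) • complexCoord j)) p := by
  have h1 : HasFDerivAt (fun q : Pt N => G.eval (complexCoord j q))
      ((G.derivative.eval (complexCoord j p)) • complexCoord j : Pt N →L[ℝ] ℂ) p :=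
    ((G.hasDerivAt (complexCoord j p)).comp_hasFDerivAt_of_eq p
      (complexCoord j).hasFDerivAt rfl)
  refine (Complex.reCLM.hasFDerivAt.comp p (h1.mul_const c)).congr_fderiv ?_
  ext w <;> simp <;> ring

lemma contDiff_torsionFn {n : WithTop ℕ∞} : ContDiff ℝ n (torsionFn N G ε) := by
  have h (j : Fin N) : ContDiff ℝ n fun q : Pt N => (G.eval (complexCoord j q)).re :=
    Complex.reCLM.contDiff.comp
      (((Polynomial.contDiff_aeval G n).restrict_scalars ℝ).comp (complexCoord j).contDiff)
  unfold torsionFn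
  have h' : ContDiff ℝ n fun q : Pt N => ∑ j, (G.eval (complexCoord j q)).re :=
    ContDiff.sum fun j _ => h j
  have h2 : ContDiff ℝ n fun q : Pt N => ∑ j, q.2 j ^ 2 :=
    ContDiff.sum fun j _ => by fun_prop
  fun_prop

lemma fderiv_torsionFn_apply (p w : Pt N) :
    fderiv ℝ (torsionFn N G ε) p w = -(1 / N) * ∑ j, p.2 j * w.2 j -
      ε * ∑ j, (G.derivative.eval (complexCoord j p) * complexCoord j w).re := by
  have h1 (j : Fin N) := hasFDerivAt_re_eval_mul G 1 j p
  have h2 (j : Fin N) : HasFDerivAt (fun q : Pt N => q.2 j)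
      ((ContinuousLinearMap.proj j).comp (ContinuousLinearMap.snd ℝ ℝ (Fin N → ℝ))) p :=
    ContinuousLinearMap.hasFDerivAt
      ((ContinuousLinearMap.proj j).comp (ContinuousLinearMap.snd ℝ ℝ (Fin N → ℝ)))
  have h3 := (((HasFDerivAt.fun_sum (u := Finset.univ) fun j _ => (h2 j).pow 2).const_mul
    (N : ℝ)⁻¹).const_sub 1).const_mul (1 / 2)
  have h4 := h3.sub ((HasFDerivAt.fun_sum (u := Finset.univ) fun j _ => h1 j).const_mul ε)
  have e : torsionFn N G ε = fun q => 1 / 2 * (1 - (N : ℝ)⁻¹ * ∑ j, q.2 j ^ 2)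
      - ε * ∑ j, (G.eval (complexCoord j q) * 1).re := by
    funext q
    simp only [torsionFn, mul_one]
    ring
  rw [e]
  refine (congrArg (fun L : Pt N →L[ℝ] ℝ => L w) h4.fderiv).trans ?_
  simp [Finset.mul_sum]
  refine Finset.sum_congr rfl fun j _ => ?_
  ring

lemma D2_torsionFn (v w p : Pt N) :
    D2 (torsionFn N G ε) v w p = -(1 / N) * ∑ j, v.2 j * w.2 j -
      ε * ∑ j, (G.derivative.derivative.eval (complexCoord j p) *
        (complexCoord j v * complexCoord j w)).re := by
  have h1 (j : Fin N) := hasFDerivAt_re_eval_mul G.derivative (complexCoord j w) j p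
  have h2 (j : Fin N) : HasFDerivAt (fun q : Pt N => q.2 j)
      ((ContinuousLinearMap.proj j).comp (ContinuousLinearMap.snd ℝ ℝ (Fin N → ℝ))) p :=
    ContinuousLinearMap.hasFDerivAt
      ((ContinuousLinearMap.proj j).comp (ContinuousLinearMap.snd ℝ ℝ (Fin N → ℝ)))
  have h3 := ((HasFDerivAt.fun_sum (u := Finset.univ) fun j _ =>
    (h2 j).mul_const (w.2 j)).const_mul (-(1 / (N : ℝ))))
  have h4 := h3.sub ((HasFDerivAt.fun_sum (u := Finset.univ) fun j _ => h1 j).const_mul ε)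
  rw [D2, funext fun q => fderiv_torsionFn_apply G ε q w]
  refine (congrArg (fun L : Pt N →L[ℝ] ℝ => L v) h4.fderiv).trans ?_
  simp [Finset.mul_sum]
  simp only [← Finset.sum_sub_distrib]
  congr 1
  · exact congrArg _ (Finset.sum_congr rfl fun j _ => by ring)
  · exact congrArg _ (Finset.sum_congr rfl fun j _ => by ring)

@[simp] lemma complexCoord_one_zero (j : Fin N) : complexCoord j ((1, 0) : Pt N) = 1 := by
  apply Complex.ext <;> simp

lemma complexCoord_zero_single (i j : Fin N) :
    complexCoord j ((0, Pi.single i 1) : Pt N) = if j = i then Complex.I else 0 := by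
  apply Complex.ext <;> split_ifs with h <;> simp [h]

lemma D2_torsionFn_x_x (p : Pt N) :
    D2 (torsionFn N G ε) (1, 0) (1, 0) p =
      -ε * ∑ j, (G.derivative.derivative.eval (complexCoord j p)).re := by
  simp [D2_torsionFn]

lemma D2_torsionFn_y_y (j : Fin N) (p : Pt N) :
    D2 (torsionFn N G ε) (0, Pi.single j 1) (0, Pi.single j 1) p =
      -(1 / N) + ε * (G.derivative.derivative.eval (complexCoord j p)).re := by
  simp [D2_torsionFn, complexCoord_zero_single, apply_ite Complex.re, Pi.single_apply]

lemma D2_torsionFn_y_y_of_ne {i j : Fin N} (hij : i ≠ j) (p : Pt N) :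
    D2 (torsionFn N G ε) (0, Pi.single i 1) (0, Pi.single j 1) p = 0 := by
  simp [D2_torsionFn, complexCoord_zero_single, apply_ite Complex.re, Pi.single_apply,
    hij.symm]

lemma D2_torsionFn_x_y (j : Fin N) (p : Pt N) :
    D2 (torsionFn N G ε) (1, 0) (0, Pi.single j 1) p =
      ε * (G.derivative.derivative.eval (complexCoord j p)).im := by
  simp [D2_torsionFn, complexCoord_zero_single, apply_ite Complex.re]

lemma lap_torsionFn (hN : N ≠ 0) (p : Pt N) : lap (torsionFn N G ε) p = -1 := by
  have : (N : ℝ) ≠ 0 := by exact_mod_cast hN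
  simp only [lap, D2_torsionFn_x_x, D2_torsionFn_y_y, Finset.sum_add_distrib, ← Finset.mul_sum]
  simp
  field_simp

lemma fderiv_torsionFn_self_sub (hN : N ≠ 0) (p : Pt N) :
    fderiv ℝ (torsionFn N G ε) p p - 2 * torsionFn N G ε p = -1 +
      ε * ∑ j, (2 * G.eval (complexCoord j p) -
        complexCoord j p * G.derivative.eval (complexCoord j p)).re := by
  have : (N : ℝ) ≠ 0 := by exact_mod_cast hN
  simp only [fderiv_torsionFn_apply, torsionFn, Complex.sub_re, Finset.sum_sub_distrib]
  simp only [← pow_two, mul_comm (complexCoord _ p)]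
  have e : ∑ j : Fin N, (2 * G.eval (complexCoord j p)).re =
      2 * ∑ j : Fin N, (G.eval (complexCoord j p)).re := by
    simp [Finset.mul_sum]
  rw [e]
  ring

end torsionFn

/-- The positivity set of `torsionFn` in the cylinder `|y|² < N + 1`. -/
def torsionDomain (N : ℕ) (G : Polynomial ℂ) (ε : ℝ) : Set (Pt N) :=
  {p | 0 < torsionFn N G ε p ∧ ∑ j, p.2 j ^ 2 < N + 1}

/-- Estimates on the strip `|Im z| ≤ N + 1` under which the perturbation is controlled. -/
structure IsSmallPerturbation (N : ℕ) (G : Polynomial ℂ) (C ε : ℝ) : Prop where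
  pos : 0 < ε
  norm_le : ∀ z : ℂ, |z.im| ≤ N + 1 → ‖z‖ ≤ (G.eval z).re + C
  norm_derivative_derivative_le : ∀ z : ℂ, |z.im| ≤ N + 1 →
    ‖G.derivative.derivative.eval z‖ ≤ 1 / (8 * N) * (G.eval z).re + C
  re_le : ∀ z : ℂ, |z.im| ≤ N + 1 → (2 * G.eval z - z * G.derivative.eval z).re ≤ C
  lt : ε * (N * C) < 1 / (16 * N)

namespace IsSmallPerturbation

variable {N : ℕ} {G : Polynomial ℂ} {C ε : ℝ}

lemma abs_im_le {p : Pt N} (hp : ∑ j, p.2 j ^ 2 ≤ N + 1) (j : Fin N) :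
    |(complexCoord j p).im| ≤ N + 1 := by
  have h1 : p.2 j ^ 2 ≤ ∑ j, p.2 j ^ 2 :=
    Finset.single_le_sum (f := fun j => p.2 j ^ 2) (fun i _ => sq_nonneg _) (Finset.mem_univ j)
  have hN : (0 : ℝ) ≤ N := N.cast_nonneg
  rw [complexCoord_im]
  exact abs_le_of_sq_le_sq (by nlinarith) (by linarith)

lemma neg_le_sum (h : IsSmallPerturbation N G C ε) {p : Pt N} (hp : ∑ j, p.2 j ^ 2 ≤ N + 1) :
    -(N * C) ≤ ∑ j, (G.eval (complexCoord j p)).re := by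
  have : ∑ _j : Fin N, (-C) ≤ ∑ j, (G.eval (complexCoord j p)).re :=
    Finset.sum_le_sum fun j _ => by
      linarith [h.norm_le _ (abs_im_le hp j), norm_nonneg (complexCoord j p)]
  simpa using this

lemma torsionFn_neg (h : IsSmallPerturbation N G C ε) (hN : 0 < N) {p : Pt N}
    (hp : ∑ j, p.2 j ^ 2 = N + 1) : torsionFn N G ε p < 0 := by
  have hN' : (0 : ℝ) < N := by exact_mod_cast hN
  have h1 := mul_le_mul_of_nonneg_left (h.neg_le_sum hp.le) h.pos.le
  have h2 := h.lt
  have e : (1 - ((N : ℝ) + 1) / N) / 2 = -(8 * (1 / (16 * N))) := by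
    field_simp
    ring
  have h3 : 0 < 1 / (16 * (N : ℝ)) := by positivity
  rw [torsionFn, hp, e]
  linarith

lemma fderiv_self_lt (h : IsSmallPerturbation N G C ε) (hN : 0 < N) {p : Pt N}
    (hp : ∑ j, p.2 j ^ 2 ≤ N + 1) :
    fderiv ℝ (torsionFn N G ε) p p < 2 * torsionFn N G ε p := by
  have h1 : ∑ j, (2 * G.eval (complexCoord j p) -
      complexCoord j p * G.derivative.eval (complexCoord j p)).re ≤ ∑ _j : Fin N, C :=
    Finset.sum_le_sum fun j _ => h.re_le _ (abs_im_le hp j)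
  simp only [Finset.sum_const, Finset.card_univ, Fintype.card_fin, nsmul_eq_mul] at h1
  have h2 := mul_le_mul_of_nonneg_left h1 h.pos.le
  have h3 := fderiv_torsionFn_self_sub G ε hN.ne' p
  have h4 := h.lt
  have h5 : 1 / (16 * (N : ℝ)) ≤ 1 := by
    have : (1 : ℝ) ≤ N := by exact_mod_cast hN
    rw [div_le_one (by positivity)]
    linarith
  linarith

lemma mul_sum_le {p : Pt N} (h0 : 0 ≤ torsionFn N G ε p) :
    ε * ∑ j, (G.eval (complexCoord j p)).re ≤ 1 / 2 := by
  have : 0 ≤ (∑ j, p.2 j ^ 2) / (N : ℝ) :=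
    div_nonneg (Finset.sum_nonneg fun _ _ => sq_nonneg _) N.cast_nonneg
  rw [torsionFn] at h0
  linarith

lemma mul_norm_derivative_derivative_le (h : IsSmallPerturbation N G C ε) {p : Pt N}
    (h0 : 0 ≤ torsionFn N G ε p) (hp : ∑ j, p.2 j ^ 2 ≤ N + 1) (j : Fin N) :
    ε * ‖G.derivative.derivative.eval (complexCoord j p)‖ ≤ 1 / (8 * N) := by
  have h1 : ‖G.derivative.derivative.eval (complexCoord j p)‖ ≤
      ∑ i, ‖G.derivative.derivative.eval (complexCoord i p)‖ :=
    Finset.single_le_sum (f := fun i => ‖G.derivative.derivative.eval (complexCoord i p)‖)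
      (fun i _ => norm_nonneg _) (Finset.mem_univ j)
  have h2 : ∑ i, ‖G.derivative.derivative.eval (complexCoord i p)‖ ≤
      ∑ i, (1 / (8 * N) * (G.eval (complexCoord i p)).re + C) :=
    Finset.sum_le_sum fun i _ => h.norm_derivative_derivative_le _ (abs_im_le hp i)
  rw [Finset.sum_add_distrib, ← Finset.mul_sum] at h2
  simp only [Finset.sum_const, Finset.card_univ, Fintype.card_fin, nsmul_eq_mul] at h2
  have h3 := mul_le_mul_of_nonneg_left (h1.trans h2) h.pos.le
  have h4 := mul_le_mul_of_nonneg_left (mul_sum_le h0) (by positivity : 0 ≤ 1 / (8 * (N : ℝ)))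
  have h5 := h.lt
  have e : 1 / (16 * (N : ℝ)) = 1 / (8 * N) * (1 / 2) := by
    rw [div_mul_div_comm]; norm_num; ring
  linarith

lemma isOpen_torsionDomain : IsOpen (torsionDomain N G ε) := by
  have h1 : Continuous (torsionFn N G ε) := (contDiff_torsionFn (n := 0) G ε).continuous
  have h2 : Continuous fun p : Pt N => ∑ j, p.2 j ^ 2 := by fun_prop
  exact (isOpen_lt continuous_const h1).inter (isOpen_lt h2 continuous_const)

lemma mem_frontier (h : IsSmallPerturbation N G C ε) (hN : 0 < N) {p : Pt N}
    (hp : p ∈ frontier (torsionDomain N G ε)) :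
    torsionFn N G ε p = 0 ∧ ∑ j, p.2 j ^ 2 < N + 1 := by
  have hc : Continuous (torsionFn N G ε) := (contDiff_torsionFn (n := 0) G ε).continuous
  have hc' : Continuous fun p : Pt N => ∑ j, p.2 j ^ 2 := by fun_prop
  rw [isOpen_torsionDomain.frontier_eq] at hp
  have h1 : closure (torsionDomain N G ε) ⊆
      {p | 0 ≤ torsionFn N G ε p ∧ ∑ j, p.2 j ^ 2 ≤ N + 1} :=
    closure_minimal (fun q hq => ⟨hq.1.le, hq.2.le⟩)
      ((isClosed_le continuous_const hc).inter (isClosed_le hc' continuous_const))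
  obtain ⟨h2, h3⟩ := h1 hp.1
  have h4 : ∑ j, p.2 j ^ 2 < N + 1 :=
    lt_of_le_of_ne h3 fun e => (h.torsionFn_neg hN e).not_ge h2
  exact ⟨le_antisymm (not_lt.1 fun h5 => hp.2 ⟨h5, h4⟩) h2, h4⟩

lemma isBounded_torsionDomain (h : IsSmallPerturbation N G C ε) (hN : 0 < N) :
    Bornology.IsBounded (torsionDomain N G ε) := by
  refine (Metric.isBounded_closedBall (x := (0 : Pt N))
    (r := max (1 / (2 * ε) + N * C) (N + 1))).subset fun p hp => ?_
  rw [mem_closedBall_zero_iff, Prod.norm_def]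
  refine max_le_max ?_ ?_
  · have h1 : ‖complexCoord ⟨0, hN⟩ p‖ ≤ ∑ i, ‖complexCoord i p‖ :=
      Finset.single_le_sum (f := fun i => ‖complexCoord i p‖)
        (fun i _ => norm_nonneg _) (Finset.mem_univ _)
    have h2 : ∑ i, ‖complexCoord i p‖ ≤ ∑ i, ((G.eval (complexCoord i p)).re + C) :=
      Finset.sum_le_sum fun i _ => h.norm_le _ (abs_im_le hp.2.le i)
    rw [Finset.sum_add_distrib] at h2
    simp only [Finset.sum_const, Finset.card_univ, Fintype.card_fin, nsmul_eq_mul] at h2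
    have h3 : ∑ i, (G.eval (complexCoord i p)).re ≤ 1 / (2 * ε) := by
      rw [le_div_iff₀ (by have := h.pos; positivity)]
      linarith [mul_sum_le hp.1.le]
    have h4 := Complex.abs_re_le_norm (complexCoord ⟨0, hN⟩ p)
    rw [complexCoord_re] at h4
    rw [Real.norm_eq_abs]
    linarith
  · rw [pi_norm_le_iff_of_nonneg (by positivity)]
    intro j
    simpa using abs_im_le hp.2.le j

lemma starShaped (h : IsSmallPerturbation N G C ε) (hN : 0 < N) {p : Pt N}
    (hp : p ∈ torsionDomain N G ε) {t : ℝ} (ht : t ∈ Ioc (0 : ℝ) 1) :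
    t • p ∈ torsionDomain N G ε := by
  have hd : Differentiable ℝ (torsionFn N G ε) :=
    (contDiff_torsionFn (n := 1) G ε).differentiable one_ne_zero
  have hsq : ∀ s ∈ Ioc (0 : ℝ) 1, ∑ j, (s • p).2 j ^ 2 < N + 1 := fun s hs =>
    lt_of_le_of_lt (Finset.sum_le_sum fun j _ => by
      simp only [Prod.smul_snd, Pi.smul_apply, smul_eq_mul, mul_pow]
      exact mul_le_of_le_one_left (sq_nonneg _) (pow_le_one₀ hs.1.le hs.2)) hp.2
  have hder : ∀ s ∈ Ioc (0 : ℝ) 1, HasDerivAt (fun s : ℝ => torsionFn N G ε (s • p) / s ^ 2)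
      ((fderiv ℝ (torsionFn N G ε) (s • p) (s • p) - 2 * torsionFn N G ε (s • p)) / s ^ 3) s := by
    intro s hs
    have h1 : HasDerivAt (fun s : ℝ => s • p) p s := by
      simpa using (hasDerivAt_id s).smul_const p
    have h2 := (hd (s • p)).hasFDerivAt.comp_hasDerivAt s h1
    have h3 := h2.div (hasDerivAt_pow 2 s) (pow_ne_zero 2 hs.1.ne')
    refine h3.congr_deriv ?_
    have := hs.1.ne'
    simp only [map_smul, smul_eq_mul, Function.comp]
    field_simp
    ring
  have hanti : AntitoneOn (fun s : ℝ => torsionFn N G ε (s • p) / s ^ 2) (Ioc 0 1) := by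
    refine antitoneOn_of_deriv_nonpos (convex_Ioc 0 1)
      (fun s hs => (hder s hs).continuousAt.continuousWithinAt)
      (fun s hs => (hder s (interior_subset hs)).differentiableAt.differentiableWithinAt)
      fun s hs => ?_
    have hs' := interior_subset hs
    rw [(hder s hs').deriv]
    exact div_nonpos_of_nonpos_of_nonneg (by linarith [h.fderiv_self_lt hN (hsq s hs').le])
      (pow_nonneg hs'.1.le 3)
  have h1 := hanti ht (right_mem_Ioc.2 one_pos) ht.2
  simp only [one_smul, one_pow, div_one] at h1
  refine ⟨?_, hsq t ht⟩
  exact (div_pos_iff_of_pos_right (pow_pos ht.1 2)).1 (hp.1.trans_le h1)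

end IsSmallPerturbation

lemma mean_curvature_bracket_lt_zero {N : ℕ} (hN : 2 ≤ N) {X A : ℝ} {Y a b : Fin N → ℝ}
    (ha : ∀ j, |a j| ≤ 1 / (8 * N)) (hb : ∀ j, |b j| ≤ 1 / (8 * N)) (hA : A ≤ 1 / 8)
    (hpos : 0 < X ^ 2 + ∑ j, Y j ^ 2) :
    (∑ j, (X ^ 2 * (-(1 / N) + a j) - 2 * X * Y j * b j + Y j ^ 2 * A)) +
      ∑ j, Y j ^ 2 * ∑ l ∈ Finset.univ.erase j, (-(1 / N) + a l) < 0 := by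
  have hN' : (2 : ℝ) ≤ N := by exact_mod_cast hN
  have hn0 : (N : ℝ) ≠ 0 := by positivity
  set d : ℝ := 1 / (8 * N) with hd
  have hNd : (N : ℝ) * d = 1 / 8 := by rw [hd]; field_simp
  have hd8 : 1 / (N : ℝ) = 8 * d := by rw [hd]; field_simp
  have hdpos : 0 < d := by positivity
  rw [hd8, ← Finset.sum_add_distrib]
  have key : ∀ j, X ^ 2 * (-(8 * d) + a j) - 2 * X * Y j * b j + Y j ^ 2 * A +
      Y j ^ 2 * ∑ l ∈ Finset.univ.erase j, (-(8 * d) + a l) ≤ -(6 * d) * X ^ 2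
        - 1 / 4 * Y j ^ 2 := by
    intro j
    have h1 : ∑ l ∈ Finset.univ.erase j, (-(8 * d) + a l) ≤
        ∑ _l ∈ Finset.univ.erase j, -(7 * d) :=
      Finset.sum_le_sum fun l _ => by linarith [(abs_le.1 (ha l)).2]
    rw [Finset.sum_const, Finset.card_erase_of_mem (Finset.mem_univ j), Finset.card_univ,
      Fintype.card_fin, nsmul_eq_mul, Nat.cast_sub (by omega)] at h1
    have hd16 : d ≤ 1 / 16 := by nlinarith
    have h2 : ∑ l ∈ Finset.univ.erase j, (-(8 * d) + a l) ≤ -(7 / 16) := by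
      push_cast at h1
      nlinarith
    have h3 := mul_le_mul_of_nonneg_left h2 (sq_nonneg (Y j))
    have h4 := mul_le_mul_of_nonneg_left hA (sq_nonneg (Y j))
    have h5 := mul_le_mul_of_nonneg_left (abs_le.1 (ha j)).2 (sq_nonneg X)
    have h6 : -(2 * X * Y j * b j) ≤ d * (X ^ 2 + Y j ^ 2) := by
      obtain ⟨hb1, hb2⟩ := abs_le.1 (hb j)
      nlinarith [mul_nonneg (sub_nonneg.2 hb2) (sq_nonneg (X - Y j)),
        mul_nonneg (neg_le_iff_add_nonneg.1 hb1) (sq_nonneg (X + Y j))]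
    nlinarith [mul_nonneg (sub_nonneg.2 hd16) (sq_nonneg (Y j))]
  refine (Finset.sum_le_sum fun j _ => key j).trans_lt ?_
  rw [Finset.sum_sub_distrib, ← Finset.mul_sum]
  simp only [Finset.sum_const, Finset.card_univ, Fintype.card_fin, nsmul_eq_mul]
  rw [← Finset.mul_sum]
  have e : -(6 * d) * (N * X ^ 2) = -(6 / 8) * X ^ 2 := by
    rw [show -(6 * d) * (N * X ^ 2) = -6 * (N * d) * X ^ 2 by ring, hNd]
    ring
  nlinarith [sq_nonneg X]

lemma fderiv_apply_eq_Dx_add_sum_Dy {N : ℕ} (u : Pt N → ℝ) (p w : Pt N) :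
    fderiv ℝ u p w = w.1 * Dx u p + ∑ j, w.2 j * Dy u j p := by
  have e : w = w.1 • ((1, 0) : Pt N) + ∑ j, w.2 j • ((0, Pi.single j 1) : Pt N) := by
    refine Prod.ext ?_ ?_
    · simp [Prod.fst_sum]
    · ext i
      simp [Prod.snd_sum, Pi.single_apply]
  conv_lhs => rw [e]
  rw [map_add, map_sum]
  simp only [map_smul, smul_eq_mul, Dx, Dy]

lemma gradSq_pos {N : ℕ} {u : Pt N → ℝ} {p : Pt N} (h : fderiv ℝ u p ≠ 0) : 0 < gradSq u p := by
  have h0 : 0 ≤ ∑ j : Fin N, Dy u j p ^ 2 := Finset.sum_nonneg fun _ _ => sq_nonneg _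
  refine lt_of_le_of_ne (add_nonneg (sq_nonneg _) h0) fun e => h ?_
  have hx : Dx u p = 0 := by
    rw [gradSq] at e
    nlinarith [sq_nonneg (Dx u p)]
  have hy : ∑ j : Fin N, Dy u j p ^ 2 = 0 := by
    rw [gradSq] at e
    nlinarith [sq_nonneg (Dx u p)]
  have hy' := (Finset.sum_eq_zero_iff_of_nonneg fun _ _ => sq_nonneg _).1 hy
  refine ContinuousLinearMap.ext fun w => ?_
  rw [fderiv_apply_eq_Dx_add_sum_Dy, hx]
  simp [fun j => pow_eq_zero_iff (two_ne_zero) |>.1 (hy' j (Finset.mem_univ j))]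

lemma IsSmallPerturbation.Km_pos {N : ℕ} {G : Polynomial ℂ} {C ε : ℝ} (hN : 2 ≤ N)
    (h : IsSmallPerturbation N G C ε) {p : Pt N} (h0 : 0 ≤ torsionFn N G ε p)
    (hp : ∑ j, p.2 j ^ 2 ≤ N + 1) (hgrad : fderiv ℝ (torsionFn N G ε) p ≠ 0) :
    0 < Km N (torsionFn N G ε) p := by
  have hg := gradSq_pos hgrad
  have hN' : (0 : ℝ) < N := by exact_mod_cast (by omega : 0 < N)
  have hδ := h.mul_norm_derivative_derivative_le h0 hp
  have hre : ∀ j, |ε * (G.derivative.derivative.eval (complexCoord j p)).re| ≤ 1 / (8 * N) :=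
    fun j => by
      rw [abs_mul, abs_of_pos h.pos]
      exact (mul_le_mul_of_nonneg_left (Complex.abs_re_le_norm _) h.pos.le).trans (hδ j)
  have him : ∀ j, |ε * (G.derivative.derivative.eval (complexCoord j p)).im| ≤ 1 / (8 * N) :=
    fun j => by
      rw [abs_mul, abs_of_pos h.pos]
      exact (mul_le_mul_of_nonneg_left (Complex.abs_im_le_norm _) h.pos.le).trans (hδ j)
  have hA : -ε * ∑ j, (G.derivative.derivative.eval (complexCoord j p)).re ≤ 1 / 8 := by
    have h1 : ∑ j, -(ε * (G.derivative.derivative.eval (complexCoord j p)).re) ≤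
        ∑ _j : Fin N, 1 / (8 * (N : ℝ)) :=
      Finset.sum_le_sum fun j _ => (neg_le_abs _).trans (hre j)
    rw [Finset.sum_neg_distrib, ← Finset.mul_sum] at h1
    have e : ∑ _j : Fin N, 1 / (8 * (N : ℝ)) = 1 / 8 := by
      simp
      field_simp
    linarith
  have := mean_curvature_bracket_lt_zero hN hre him hA hg
  rw [Km]
  simp only [D2_torsionFn_x_x, D2_torsionFn_y_y, D2_torsionFn_x_y]
  rw [neg_mul, ← mul_neg]
  exact mul_pos (by positivity) (neg_pos.2 this)

lemma volume_sum_sq_eq {N : ℕ} {r : ℝ} (hr : 0 < r) :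
    volume {p : Pt N | ∑ j, p.2 j ^ 2 = r} = 0 := by
  have hconv : Convex ℝ {p : Pt N | ∑ j, p.2 j ^ 2 ≤ r} := by
    have h1 : ConvexOn ℝ univ fun p : Pt N => ∑ j, p.2 j ^ 2 := by
      refine ⟨convex_univ, fun p _ q _ a b ha hb hab => ?_⟩
      simp only [smul_eq_mul, Finset.mul_sum, ← Finset.sum_add_distrib]
      refine Finset.sum_le_sum fun j _ => ?_
      exact (even_two.convexOn_pow (𝕜 := ℝ)).2 (mem_univ (p.2 j)) (mem_univ (q.2 j)) ha hb hab
    simpa using h1.convex_le r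
  have : (volume : Measure (Pt N)).IsAddHaarMeasure :=
    inferInstanceAs ((volume : Measure ℝ).prod (volume : Measure (Fin N → ℝ))).IsAddHaarMeasure
  refine measure_mono_null (fun p hp => ?_) (hconv.addHaar_frontier volume)
  refine ⟨subset_closure (le_of_eq hp), fun hint => ?_⟩
  have hcont : Tendsto (fun s : ℝ => s • p) (𝓝[>] 1) (𝓝 p) := by
    have : Continuous fun s : ℝ => s • p := by fun_prop
    simpa using (this.tendsto 1).mono_left nhdsWithin_le_nhds
  obtain ⟨s, hs, hs1⟩ := ((hcont.eventually (mem_interior_iff_mem_nhds.1 hint)).and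
    self_mem_nhdsWithin).exists
  have e : ∑ j, (s • p).2 j ^ 2 = s ^ 2 * r := by
    rw [← show ∑ j, p.2 j ^ 2 = r from hp, Finset.mul_sum]
    simp [mul_pow]
  have h2 : s ^ 2 * r ≤ r := e ▸ hs
  have h3 : (1 : ℝ) < s := hs1
  nlinarith [mul_pos hr (sub_pos.2 h3)]

lemma exists_volume_shell_lt {N : ℕ} (hN : 0 < N) {K : Set (Pt N)} (hK : IsCompact K) {η : ℝ}
    (hη : 0 < η) :
    ∃ r > 0, volume (K ∩ {p : Pt N | |∑ j, p.2 j ^ 2 - N| ≤ r}) < ENNReal.ofReal η := by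
  have hc : Continuous fun p : Pt N => |∑ j, p.2 j ^ 2 - (N : ℝ)| := by fun_prop
  have ht := tendsto_measure_biInter_gt (μ := (volume : Measure (Pt N))) (a := (0 : ℝ))
    (s := fun r => K ∩ {p : Pt N | |∑ j, p.2 j ^ 2 - (N : ℝ)| ≤ r})
    (fun r _ => (hK.measurableSet.inter
      (isClosed_le hc continuous_const).measurableSet).nullMeasurableSet)
    (fun i j _ hij => inter_subset_inter_right _ fun p (hp : _ ≤ i) => hp.trans hij)
    ⟨1, one_pos, ((measure_mono inter_subset_left).trans_lt hK.measure_lt_top).ne⟩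
  have h0 : volume (⋂ r > (0 : ℝ), K ∩ {p : Pt N | |∑ j, p.2 j ^ 2 - (N : ℝ)| ≤ r}) = 0 := by
    refine measure_mono_null (fun p hp => ?_)
      (volume_sum_sq_eq (N := N) (r := N) (by exact_mod_cast hN))
    simp only [mem_iInter] at hp
    have h1 : |∑ j, p.2 j ^ 2 - (N : ℝ)| ≤ 0 :=
      le_of_forall_gt_imp_ge_of_dense fun r hr => (hp r hr).2
    exact sub_eq_zero.1 (abs_nonpos_iff.1 h1)
  rw [h0] at ht
  obtain ⟨r, hr, hr0⟩ := ((ht.eventually_lt_const (ENNReal.ofReal_pos.2 hη)).and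
    self_mem_nhdsWithin).exists
  exact ⟨r, hr0, hr⟩

lemma inter_symmDiff_torsionDomain_subset {N : ℕ} (hN : 0 < N) {G : Polynomial ℂ} {ε M : ℝ}
    (hε : 0 < ε) {K : Set (Pt N)}
    (hM : ∀ p ∈ K, |∑ j, (G.eval (complexCoord j p)).re| ≤ M) :
    K ∩ symmDiff {p : Pt N | ∑ j, (p.2 j) ^ 2 < (N : ℝ)} (torsionDomain N G ε) ⊆
      K ∩ {p : Pt N | |∑ j, p.2 j ^ 2 - N| ≤ 2 * N * M * ε} := by
  have hN' : (0 : ℝ) < N := by exact_mod_cast hN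
  rintro p ⟨hpK, hp⟩
  refine ⟨hpK, ?_⟩
  obtain ⟨hM1, hM2⟩ := abs_le.1 (hM p hpK)
  have e : ∑ j, p.2 j ^ 2 - N = -(2 * N * (torsionFn N G ε p)) -
      2 * N * (ε * ∑ j, (G.eval (complexCoord j p)).re) := by
    rw [torsionFn]
    field_simp
    ring
  have hb1 : 2 * N * (ε * ∑ j, (G.eval (complexCoord j p)).re) ≤ 2 * N * M * ε := by
    have : 0 ≤ 2 * N * ε := by positivity
    nlinarith [mul_le_mul_of_nonneg_left hM2 this]
  have hb2 : -(2 * N * M * ε) ≤ 2 * N * (ε * ∑ j, (G.eval (complexCoord j p)).re) := by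
    have : 0 ≤ 2 * N * ε := by positivity
    nlinarith [mul_le_mul_of_nonneg_left hM1 this]
  rw [mem_ofPred_eq, abs_le]
  rcases hp with ⟨h1, h2⟩ | ⟨h1, h2⟩
  · have h1' : ∑ j, p.2 j ^ 2 < N := h1
    have hu : torsionFn N G ε p ≤ 0 := not_lt.1 fun hu => h2 ⟨hu, by linarith⟩
    have : 2 * N * torsionFn N G ε p ≤ 0 := mul_nonpos_of_nonneg_of_nonpos (by positivity) hu
    constructor <;> linarith
  · have h2' : (N : ℝ) ≤ ∑ j, p.2 j ^ 2 := not_lt.1 h2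
    have : 0 < 2 * N * torsionFn N G ε p := mul_pos (by positivity) h1.1
    constructor <;> linarith

/-- The square of a real polynomial with simple roots `0, …, m - 1`. -/
def sqNodal (m : ℕ) : Polynomial ℝ :=
  Lagrange.nodal (Finset.range m) (fun i : ℕ => (i : ℝ)) ^ 2

lemma sqNodal_monic (m : ℕ) : (sqNodal m).Monic := (Lagrange.nodal_monic).pow 2

lemma natDegree_sqNodal (m : ℕ) : (sqNodal m).natDegree = 2 * m := by
  rw [sqNodal, Polynomial.natDegree_pow, Lagrange.natDegree_nodal, Finset.card_range]

lemma eval_sqNodal {m i : ℕ} (hi : i < m) : (sqNodal m).eval (i : ℝ) = 0 := by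
  rw [sqNodal, Polynomial.eval_pow,
    Lagrange.eval_nodal_at_node (v := fun i : ℕ => (i : ℝ)) (Finset.mem_range.2 hi)]
  simp

lemma eval_derivative_sqNodal {m i : ℕ} (hi : i < m) :
    (sqNodal m).derivative.eval (i : ℝ) = 0 := by
  have h := Lagrange.eval_nodal_at_node (v := fun i : ℕ => (i : ℝ)) (Finset.mem_range.2 hi)
  simp [sqNodal, pow_two, Polynomial.derivative_mul, h]

lemma eval_derivative_derivative_sqNodal_pos {m i : ℕ} (hi : i < m) :
    0 < (sqNodal m).derivative.derivative.eval (i : ℝ) := by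
  have h := Lagrange.eval_nodal_at_node (v := fun i : ℕ => (i : ℝ)) (Finset.mem_range.2 hi)
  have h' := Lagrange.eval_nodal_derivative_eval_node_eq (v := fun i : ℕ => (i : ℝ))
    (Finset.mem_range.2 hi)
  have hne : (Lagrange.nodal (Finset.range m) fun i : ℕ => (i : ℝ)).derivative.eval (i : ℝ) ≠ 0 := by
    rw [h', Lagrange.eval_nodal]
    refine Finset.prod_ne_zero_iff.2 fun j hj => sub_ne_zero.2 ?_
    exact_mod_cast (Finset.ne_of_mem_erase hj).symm
  have := pow_pos (abs_pos.2 hne) 2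
  rw [sq_abs] at this
  simp only [sqNodal, pow_two, Polynomial.derivative_mul, Polynomial.derivative_add,
    Polynomial.eval_add, Polynomial.eval_mul, h]
  nlinarith

lemma exists_isSmallPerturbation {N m : ℕ} (hN : 0 < N) (hm : 2 ≤ m) {G : Polynomial ℂ}
    (hG : G.Monic) (hd : G.natDegree = 2 * m) :
    ∃ C, ∃ ε₀ > 0, ∀ ε, 0 < ε → ε ≤ ε₀ → IsSmallPerturbation N G C ε := by
  have hN' : (0 : ℝ) < N := by exact_mod_cast hN
  have hR : (0 : ℝ) ≤ N + 1 := by positivity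
  have hdeg : G.degree = ((2 * m : ℕ) : WithBot ℕ) := by
    rw [Polynomial.degree_eq_natDegree hG.ne_zero, hd]
  obtain ⟨C₁, h₁⟩ := exists_norm_eval_le_mul_re_eval_add (Q := Polynomial.X) (by omega) hG hd
    (by rw [Polynomial.degree_X]; exact_mod_cast (by omega : 1 < 2 * m)) hR one_pos
  obtain ⟨C₂, h₂⟩ := exists_norm_eval_le_mul_re_eval_add (Q := G.derivative.derivative)
    (by omega) hG hd
    (((Polynomial.degree_derivative_le).trans_lt
      (Polynomial.degree_derivative_lt hG.ne_zero)).trans_eq hdeg) hR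
    (τ := 1 / (8 * N)) (by positivity)
  obtain ⟨C₃, h₃⟩ := exists_re_two_mul_sub_mul_derivative_le hm hG hd hR
  set C := max 0 (max C₁ (max C₂ C₃)) with hC
  have hC0 : 0 ≤ C := le_max_left _ _
  have hC1 : C₁ ≤ C := by simp [hC]
  have hC2 : C₂ ≤ C := by simp [hC]
  have hC3 : C₃ ≤ C := by simp [hC]
  refine ⟨C, 1 / (16 * N) / (N * C + 1), by positivity, fun ε hε hle => ⟨hε, fun z hz => ?_,
    fun z hz => (h₂ z hz).trans (by linarith), fun z hz => (h₃ z hz).trans hC3, ?_⟩⟩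
  · have := h₁ z hz
    rw [Polynomial.eval_X, one_mul] at this
    linarith
  · rw [le_div_iff₀ (by positivity)] at hle
    linarith

lemma D2_torsionFn_neg_of_small {N : ℕ} (hN : 0 < N) {G : Polynomial ℂ} {ε x c : ℝ}
    (hε : 0 < ε) (hG : G.derivative.derivative.eval (x : ℂ) = c) (hc : 0 < c)
    (hsmall : ε * c ≤ 1 / (8 * N)) {w : Pt N} (hw : w ≠ 0) :
    D2 (torsionFn N G ε) w w (x, 0) < 0 := by
  have hN' : (0 : ℝ) < N := by exact_mod_cast hN
  have hz : ∀ j : Fin N, complexCoord j ((x, 0) : Pt N) = x := fun j => by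
    apply Complex.ext <;> simp
  have e : D2 (torsionFn N G ε) w w (x, 0) =
      -(N * (ε * c) * w.1 ^ 2) - (1 / N - ε * c) * ∑ j, w.2 j ^ 2 := by
    rw [D2_torsionFn]
    simp only [hz, hG, Complex.re_ofReal_mul, Complex.mul_re (complexCoord _ w), complexCoord_re,
      complexCoord_im]
    simp only [← pow_two]
    rw [← Finset.mul_sum, Finset.sum_sub_distrib]
    simp only [Finset.sum_const, Finset.card_univ, Fintype.card_fin, nsmul_eq_mul]
    ring
  have h1 : 0 < 1 / N - ε * c := by
    have : 1 / (8 * (N : ℝ)) < 1 / N := one_div_lt_one_div_of_lt hN' (by linarith)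
    linarith
  have h2 : 0 ≤ ∑ j, w.2 j ^ 2 := Finset.sum_nonneg fun _ _ => sq_nonneg _
  have h3 : 0 < N * (ε * c) := by positivity
  rw [e]
  by_cases hw1 : w.1 = 0
  · have hw2 : w.2 ≠ 0 := fun h => hw (Prod.ext hw1 h)
    obtain ⟨j, hj⟩ := Function.ne_iff.1 hw2
    have h4 : 0 < ∑ j, w.2 j ^ 2 := Finset.sum_pos' (fun _ _ => sq_nonneg _)
      ⟨j, Finset.mem_univ j, by have : w.2 j ≠ 0 := hj; positivity⟩
    rw [hw1]
    nlinarith [mul_pos h1 h4]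
  · have : 0 < w.1 ^ 2 := by positivity
    nlinarith [mul_pos h3 this, mul_nonneg h1.le h2]

theorem statement1 (N : ℕ) (hN : 2 ≤ N) (k : ℕ)
    (K : Set (Pt N)) (hK : IsCompact K) (η : ℝ) (hη : 0 < η) :
    ∃ (Ω : Set (Pt N)) (u : Pt N → ℝ),
      IsOpen Ω ∧ Bornology.IsBounded Ω ∧ SmoothBoundary Ω ∧
      -- (i) star-shaped with respect to an interior point
      (∃ p₀ ∈ Ω, ∀ p ∈ Ω, ∀ t ∈ Ioc (0:ℝ) 1, p₀ + t • (p - p₀) ∈ Ω) ∧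
      -- (ii) Ω is close to the cylinder 𝒞 = {|y|² < N} on the compact K
      volume (K ∩ symmDiff {p : Pt N | ∑ j, (p.2 j) ^ 2 < (N : ℝ)} Ω) < ENNReal.ofReal η ∧
      -- u positive and smooth in Ω, C² up to the closure
      ContDiffOn ℝ (⊤ : ℕ∞) u Ω ∧ ContDiffOn ℝ 2 u (closure Ω) ∧
      (∀ p ∈ Ω, 0 < u p) ∧
      -- (iii) on ∂Ω: nonvanishing gradient, vanishing mixed y-derivatives,
      -- and strictly positive mean curvature
      (∀ p ∈ frontier Ω,
        fderiv ℝ u p ≠ 0 ∧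
        (∀ i j : Fin N, i ≠ j → D2 u (0, Pi.single i 1) (0, Pi.single j 1) p = 0) ∧
        0 < Km N u p) ∧
      -- (iv) u solves the torsion problem
      (∀ p ∈ Ω, lap u p = -1) ∧
      (∀ p ∈ frontier Ω, u p = 0) ∧
      -- (v) at least k nondegenerate local maximum points
      (∃ S : Finset (Pt N), k ≤ S.card ∧ ∀ p ∈ S, p ∈ Ω ∧
        fderiv ℝ u p = 0 ∧ ∀ w : Pt N, w ≠ 0 → D2 u w w p < 0) := by
  have hN0 : 0 < N := by omega
  have hN' : (0 : ℝ) < N := by exact_mod_cast hN0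
  set m := k + 2 with hm
  set G : Polynomial ℂ := (sqNodal m).map Complex.ofRealHom with hGdef
  have hG : G.Monic := (sqNodal_monic m).map _
  have hd : G.natDegree = 2 * m := by
    rw [hGdef, (sqNodal_monic m).natDegree_map, natDegree_sqNodal]
  have hev : ∀ (Q : Polynomial ℝ) (x : ℝ), (Q.map Complex.ofRealHom).eval (x : ℂ) = Q.eval x :=
    fun Q x => by
      rw [Polynomial.eval_map]
      exact Polynomial.eval₂_at_apply Complex.ofRealHom x
  have hG0 : ∀ i < m, G.eval ((i : ℝ) : ℂ) = 0 := fun i hi => by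
    rw [hev, eval_sqNodal hi, Complex.ofReal_zero]
  have hG1 : ∀ i < m, G.derivative.eval ((i : ℝ) : ℂ) = 0 := fun i hi => by
    rw [hGdef, Polynomial.derivative_map, hev, eval_derivative_sqNodal hi, Complex.ofReal_zero]
  have hG2 : ∀ i : ℕ, G.derivative.derivative.eval ((i : ℝ) : ℂ) =
      ((sqNodal m).derivative.derivative.eval (i : ℝ) : ℝ) := fun i => by
    rw [hGdef, Polynomial.derivative_map, Polynomial.derivative_map, hev]
  obtain ⟨C, ε₀, hε₀, hsmall⟩ := exists_isSmallPerturbation hN0 (by omega) hG hd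
  obtain ⟨r, hr, hvol⟩ := exists_volume_shell_lt hN0 hK hη
  have hcont : Continuous fun p : Pt N => ∑ j, (G.eval (complexCoord j p)).re := by fun_prop
  obtain ⟨M₀, hM₀⟩ := hK.exists_bound_of_continuousOn hcont.continuousOn
  set M := max M₀ 1
  have hMpos : 0 < M := lt_max_of_lt_right one_pos
  have hM : ∀ p ∈ K, |∑ j, (G.eval (complexCoord j p)).re| ≤ M := fun p hp =>
    (hM₀ p hp).trans (le_max_left _ _)
  set ε := min ε₀ (r / (2 * N * M))
  have hε : 0 < ε := lt_min hε₀ (by positivity)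
  have h : IsSmallPerturbation N G C ε := hsmall ε hε (min_le_left _ _)
  have hεr : 2 * N * M * ε ≤ r := by
    rw [mul_comm, ← le_div_iff₀ (by positivity)]
    exact min_le_right _ _
  have hz : ∀ (x : ℝ) (j : Fin N), complexCoord j ((x, 0) : Pt N) = x := fun x j => by
    apply Complex.ext <;> simp
  have hmem : ∀ i < m, (((i : ℝ), 0) : Pt N) ∈ torsionDomain N G ε := fun i hi => by
    refine ⟨?_, ?_⟩
    · simp [torsionFn, hz, show G.eval (i : ℂ) = 0 from by simpa using hG0 i hi]
    · simp only [Pi.zero_apply]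
      simpa using (by linarith : (0 : ℝ) < N + 1)
  have hgrad : ∀ p ∈ frontier (torsionDomain N G ε), fderiv ℝ (torsionFn N G ε) p ≠ 0 :=
    fun p hp h0 => by
      obtain ⟨h1, h2⟩ := h.mem_frontier hN0 hp
      have h3 := h.fderiv_self_lt hN0 h2.le
      rw [h1, h0] at h3
      simp at h3
  have h00 : (0 : Pt N) ∈ torsionDomain N G ε := by
    have := hmem 0 (by omega)
    rwa [Nat.cast_zero] at this
  refine ⟨torsionDomain N G ε, torsionFn N G ε, IsSmallPerturbation.isOpen_torsionDomain,
    h.isBounded_torsionDomain hN0, fun p hp => ?_, ⟨0, h00,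
      fun p hp t ht => by simpa using h.starShaped hN0 hp ht⟩, ?_,
    (contDiff_torsionFn G ε).contDiffOn, (contDiff_torsionFn G ε).contDiffOn, fun p hp => hp.1,
    fun p hp => ?_, fun p _ => lap_torsionFn G ε hN0.ne' p, fun p hp => (h.mem_frontier hN0 hp).1,
    ?_⟩
  · refine ⟨fun q => -torsionFn N G ε q, (contDiff_torsionFn G ε).neg.contDiffAt, ?_, ?_⟩
    · rw [fderiv_fun_neg]
      exact neg_ne_zero.2 (hgrad p hp)
    · have hc : Continuous fun p : Pt N => ∑ j, p.2 j ^ 2 := by fun_prop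
      filter_upwards [(isOpen_lt hc continuous_const).mem_nhds (h.mem_frontier hN0 hp).2]
        with q hq
      rw [neg_lt_zero]
      exact ⟨fun h => h.1, fun h => ⟨h, hq⟩⟩
  · refine (measure_mono ((inter_symmDiff_torsionDomain_subset hN0 hε hM).trans ?_)).trans_lt hvol
    exact inter_subset_inter_right _ fun p (hp : _ ≤ _) => hp.trans hεr
  · obtain ⟨h1, h2⟩ := h.mem_frontier hN0 hp
    exact ⟨hgrad p hp, fun i j hij => D2_torsionFn_y_y_of_ne G ε hij p,
      h.Km_pos hN h1.ge h2.le (hgrad p hp)⟩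
  · have hinj : Function.Injective fun i : ℕ => (((i : ℝ), 0) : Pt N) := fun i j hij => by
      simpa using hij
    refine ⟨(Finset.range k).image fun i : ℕ => (((i : ℝ), 0) : Pt N), ?_, ?_⟩
    · rw [Finset.card_image_of_injective _ hinj, Finset.card_range]
    · intro p hp
      obtain ⟨i, hi, rfl⟩ := Finset.mem_image.1 hp
      have hi : i < m := by
        have := Finset.mem_range.1 hi
        omega
      refine ⟨hmem i hi, ?_, fun w hw => ?_⟩
      · refine ContinuousLinearMap.ext fun w => ?_
        rw [fderiv_torsionFn_apply]
        simp only [hz, hG1 i hi]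
        simp
      · have hpos := eval_derivative_derivative_sqNodal_pos hi
        refine D2_torsionFn_neg_of_small hN0 hε (hG2 i) hpos ?_ hw
        have h3 := h.mul_norm_derivative_derivative_le (hmem i hi).1.le (hmem i hi).2.le ⟨0, hN0⟩
        rwa [hz, hG2, Complex.norm_real, Real.norm_eq_abs, abs_of_pos hpos] at h3
end
end

section
/- Let a > 0, let q : [−a,a] → ℝ be continuous, even (q(−y) = q(y)) and nonnegative, and let μ > 0 be such that for every ξ ∈ C_c^∞((−a,a)) with ξ ≢ 0 one has ∫_{−a}^{a} (ξ')² > ∫_{−a}^{a} (q + μ) ξ². If ω ∈ C²([−a,a]) satisfies −ω'' = (q(y) + μ) ω on (−a,a) with ω(−a) = ω(a) = 1, then: (i) ω > 0 on [−a,a]; (ii) ω is even, i.e. ω(y) = ω(−y) for all y; (iii) ω'' < 0 on [−a,a] (ω is strictly concave), 0 is the maximum point of ω, and y·ω'(y) < 0 for every y ≠ 0. -/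
open MeasureTheory Set Filter Topology

noncomputable section

open scoped Convolution in
/-- An integral inequality for smooth test functions supported in an open interval extends to
continuously differentiable ones. -/
theorem integral_mul_sq_le_integral_deriv_sq_of_contDiff_one {a : ℝ} {p : ℝ → ℝ}
    (hp : ContinuousOn p (Icc (-a) a))
    (h : ∀ ξ : ℝ → ℝ, ContDiff ℝ (⊤ : ℕ∞) ξ → HasCompactSupport ξ →
      tsupport ξ ⊆ Ioo (-a) a →
      (∫ y in Ioo (-a) a, p y * (ξ y) ^ 2) ≤ ∫ y in Ioo (-a) a, (deriv ξ y) ^ 2)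
    {v : ℝ → ℝ} (hv : ContDiff ℝ 1 v) (hvc : HasCompactSupport v)
    (hvs : tsupport v ⊆ Ioo (-a) a) :
    (∫ y in Ioo (-a) a, p y * (v y) ^ 2) ≤ ∫ y in Ioo (-a) a, (deriv v y) ^ 2 := by
  obtain ⟨δ, hδ, hδs⟩ := hvc.isCompact.exists_cthickening_subset_open isOpen_Ioo hvs
  have hv' : Continuous (deriv v) := hv.continuous_deriv le_rfl
  let φ : ℕ → ContDiffBump (0 : ℝ) := fun n ↦
    ⟨δ / (n + 1) / 2, δ / (n + 1), by positivity, half_lt_self (by positivity)⟩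
  have hφ : Tendsto (fun n ↦ (φ n).rOut) atTop (𝓝 0) := by
    have := (tendsto_one_div_add_atTop_nhds_zero_nat (𝕜 := ℝ)).const_mul δ
    simpa [φ, div_eq_mul_inv] using this
  have hφδ : ∀ n, (φ n).rOut ≤ δ := fun n ↦
    div_le_self hδ.le (by linarith [(Nat.cast_nonneg n : (0 : ℝ) ≤ n)])
  let conv : (ℝ → ℝ) → ℕ → ℝ → ℝ := fun g n ↦
    (φ n).normed volume ⋆[ContinuousLinearMap.lsmul ℝ ℝ, volume] g
  have hloc : ∀ n, LocallyIntegrable ((φ n).normed volume) (volume : Measure ℝ) := fun n ↦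
    (φ n).continuous_normed.locallyIntegrable
  have hsmooth : ∀ n, ContDiff ℝ (⊤ : ℕ∞) (conv v n) := fun n ↦
    (φ n).hasCompactSupport_normed.contDiff_convolution_left _ (φ n).contDiff_normed
      hv.continuous.locallyIntegrable
  have hderiv : ∀ n, deriv (conv v n) = conv (deriv v) n := fun n ↦ funext fun x ↦
    (hvc.hasDerivAt_convolution_right _ (hloc n) hv x).deriv
  have hsupp : ∀ n, tsupport (conv v n) ⊆ Metric.cthickening δ (tsupport v) := by
    refine fun n ↦ closure_minimal ?_ Metric.isClosed_cthickening
    refine (support_convolution_subset _).trans ?_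
    rintro _ ⟨s, hs, t, ht, rfl⟩
    rw [(φ n).support_normed_eq] at hs
    refine Metric.mem_cthickening_of_dist_le _ t _ _ (subset_closure ht) ?_
    have := Metric.mem_ball.1 hs
    simp only [dist_zero_right] at this
    simpa [dist_eq_norm] using this.le.trans (hφδ n)
  have hcs : ∀ n, HasCompactSupport (conv v n) := fun n ↦
    hvc.isCompact.cthickening.of_isClosed_subset (isClosed_tsupport _) (hsupp n)
  have hbound : ∀ g : ℝ → ℝ, Continuous g → HasCompactSupport g →
      ∃ C, ∀ n x, |conv g n x| ≤ C := by
    intro g hg hgc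
    obtain ⟨C, hC⟩ := hgc.exists_bound_of_continuous hg
    refine ⟨3 * C, fun n x ↦ ?_⟩
    have h1 : dist (conv g n x) (g x) ≤ 2 * C :=
      ContDiffBump.dist_normed_convolution_le hg.aestronglyMeasurable fun y _ ↦ by
        rw [dist_eq_norm]
        linarith [norm_sub_le (g y) (g x), hC x, hC y]
    have h2 := hC x
    rw [Real.dist_eq] at h1
    rw [Real.norm_eq_abs] at h2
    have := abs_add_le (conv g n x - g x) (g x)
    rw [sub_add_cancel] at this
    linarith
  have hcont : ∀ g : ℝ → ℝ, Continuous g → ∀ n, Continuous (conv g n) := fun g hg n ↦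
    (φ n).hasCompactSupport_normed.continuous_convolution_left _ (φ n).continuous_normed
      hg.locallyIntegrable
  have hlim : ∀ (w g : ℝ → ℝ), ContinuousOn w (Icc (-a) a) → Continuous g →
      HasCompactSupport g →
      Tendsto (fun n ↦ ∫ y in Ioo (-a) a, w y * (conv g n y) ^ 2) atTop
        (𝓝 (∫ y in Ioo (-a) a, w y * (g y) ^ 2)) := by
    intro w g hw hg hgc
    obtain ⟨C, hC⟩ := hbound g hg hgc
    have hwi : IntegrableOn w (Ioo (-a) a) :=
      (hw.integrableOn_Icc).mono_set Ioo_subset_Icc_self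
    refine tendsto_integral_of_dominated_convergence (fun y ↦ |w y| * C ^ 2) (fun n ↦ ?_)
      (hwi.abs.mul_const _) (fun n ↦ ?_) ?_
    · exact hwi.aestronglyMeasurable.mul ((hcont g hg n).pow 2).aestronglyMeasurable
    · refine Eventually.of_forall fun y ↦ ?_
      rw [Real.norm_eq_abs, abs_mul, abs_pow]
      gcongr
      exact hC n y
    · exact Eventually.of_forall fun y ↦
        ((ContDiffBump.convolution_tendsto_right_of_continuous hφ hg y).pow 2).const_mul _
  have hlim' := hlim (fun _ ↦ 1) (deriv v) continuousOn_const hv' hvc.deriv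
  simp only [one_mul] at hlim'
  refine le_of_tendsto_of_tendsto' (hlim p v hp hv.continuous hvc) hlim' fun n ↦ ?_
  rw [← hderiv]
  exact h _ (hsmooth n) (hcs n) ((hsupp n).trans hδs)

/-- A continuously differentiable approximation of the positive part with slope at most one. -/
theorem exists_contDiff_approx_posPart {δ : ℝ} (hδ : 0 < δ) :
    ∃ G : ℝ → ℝ, ContDiff ℝ 1 G ∧ (∀ t, 0 ≤ deriv G t ∧ deriv G t ≤ 1) ∧
      (∀ t ≤ 0, G t = 0) ∧ ∀ t, 0 < t → 0 < G t ∧ t - δ < G t := by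
  let g : ℝ → ℝ := fun t ↦ max 0 (min 1 (t / δ))
  have hg : Continuous g := by fun_prop
  have hG : ∀ t, HasDerivAt (fun t ↦ ∫ s in (0 : ℝ)..t, g s) (g t) t := fun t ↦
    hg.integral_hasStrictDerivAt 0 t |>.hasDerivAt
  have hpos : ∀ t, 0 < t → 0 < ∫ s in (0 : ℝ)..t, g s := fun t ht ↦
    intervalIntegral.intervalIntegral_pos_of_pos_on (hg.intervalIntegrable _ _)
      (fun s hs ↦ lt_max_of_lt_right (lt_min one_pos (div_pos hs.1 hδ))) ht
  refine ⟨fun t ↦ ∫ s in (0 : ℝ)..t, g s, ?_, fun t ↦ ?_, fun t ht ↦ ?_, fun t ht ↦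
    ⟨hpos t ht, ?_⟩⟩
  · rw [contDiff_one_iff_deriv]
    exact ⟨fun t ↦ (hG t).differentiableAt, by rwa [funext fun t ↦ (hG t).deriv]⟩
  · rw [(hG t).deriv]
    exact ⟨le_max_left _ _, max_le zero_le_one (min_le_left _ _)⟩
  · change ∫ s in (0 : ℝ)..t, g s = 0
    rw [intervalIntegral.integral_congr (g := fun _ ↦ (0 : ℝ)), intervalIntegral.integral_zero]
    intro s hs
    rw [uIcc_of_ge ht] at hs
    exact max_eq_left ((min_le_right _ _).trans (div_nonpos_of_nonpos_of_nonneg hs.2 hδ.le))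
  · rcases le_or_gt t δ with h | h
    · linarith [hpos t ht]
    · have h1 : ∫ s in δ..t, g s = t - δ := by
        rw [intervalIntegral.integral_congr (g := fun _ ↦ (1 : ℝ))]
        · simp
        intro s hs
        rw [uIcc_of_le h.le] at hs
        have : 1 ≤ s / δ := (one_le_div hδ).2 hs.1
        simp [g, min_eq_left this]
      have h2 := intervalIntegral.integral_add_adjacent_intervals
        (hg.intervalIntegrable 0 δ) (hg.intervalIntegrable (μ := volume) δ t)
      simp only
      linarith [hpos δ hδ]

/-- If the quadratic form `∫ (ξ')² - ∫ p ξ²` with `p > 0` is nonnegative on test functions, then a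
solution of `-ω'' = p ω` with boundary values one is bounded below by one. -/
theorem one_le_of_neg_deriv_deriv_eq {a : ℝ} (ha : 0 < a) {p : ℝ → ℝ}
    (hp : ContinuousOn p (Icc (-a) a)) (hp0 : ∀ y ∈ Icc (-a) a, 0 < p y)
    (h : ∀ ξ : ℝ → ℝ, ContDiff ℝ (⊤ : ℕ∞) ξ → HasCompactSupport ξ →
      tsupport ξ ⊆ Ioo (-a) a →
      (∫ y in Ioo (-a) a, p y * (ξ y) ^ 2) ≤ ∫ y in Ioo (-a) a, (deriv ξ y) ^ 2)
    {ω : ℝ → ℝ} (hω : ContDiff ℝ 2 ω)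
    (hωeq : ∀ y ∈ Icc (-a) a, -(deriv (deriv ω) y) = p y * ω y)
    (hωm : ω (-a) = 1) (hωp : ω a = 1) : ∀ y ∈ Icc (-a) a, 1 ≤ ω y := by
  by_contra! ⟨y₀, hy₀, hlt⟩
  obtain ⟨δ, hδ, hδ1⟩ := exists_between (max_lt hlt one_pos)
  obtain ⟨hδy, hδ0⟩ := max_lt_iff.1 hδ
  obtain ⟨G, hG, hG', hGz, hGp⟩ := exists_contDiff_approx_posPart hδ0
  have hω' : ContDiff ℝ 1 (deriv ω) := by
    rw [← one_add_one_eq_two, contDiff_succ_iff_deriv] at hω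
    exact hω.2.2
  have hle : -a ≤ a := by linarith
  let K := Icc (-a) a ∩ {y | ω y ≤ δ}
  have hK : IsCompact K := isCompact_Icc.inter_right (isClosed_le hω.continuous continuous_const)
  have hKs : K ⊆ Ioo (-a) a := fun y ⟨hy, hyδ⟩ ↦
    ⟨hy.1.lt_of_ne (by rintro rfl; exact absurd hyδ (by simp [hωm, hδ1])),
      hy.2.lt_of_ne (by rintro rfl; exact absurd hyδ (by simp [hωp, hδ1]))⟩
  have hy₀' : y₀ ∈ Ioo (-a) a := hKs ⟨hy₀, hδy.le⟩
  let u : ℝ → ℝ := fun y ↦ G (δ - ω y)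
  have hu : ContDiff ℝ 1 u := hG.comp (contDiff_const.sub (hω.of_le (by norm_num)))
  let v : ℝ → ℝ := (Ioo (-a) a).indicator u
  have hvK : ∀ y ∉ K, v y = 0 := fun y hy ↦ by
    by_cases hyI : y ∈ Ioo (-a) a
    · have : δ < ω y := by
        by_contra! h
        exact hy ⟨Ioo_subset_Icc_self hyI, h⟩
      simp [v, hyI, u, hGz (δ - ω y) (by linarith)]
    · simp [v, hyI]
  have hvu : ∀ y ∈ Ioo (-a) a, v =ᶠ[𝓝 y] u := fun y hy ↦ by
    filter_upwards [isOpen_Ioo.mem_nhds hy] with z hz using indicator_of_mem hz _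
  have hv : ContDiff ℝ 1 v := by
    refine contDiff_iff_contDiffAt.2 fun y ↦ ?_
    by_cases hy : y ∈ K
    · exact hu.contDiffAt.congr_of_eventuallyEq (hvu y (hKs hy))
    · refine contDiffAt_const (c := (0 : ℝ)) |>.congr_of_eventuallyEq ?_
      filter_upwards [hK.isClosed.isOpen_compl.mem_nhds hy] with z hz using hvK z hz
  have hvs : tsupport v ⊆ K := closure_minimal
    (fun y hy ↦ by by_contra hyK; exact hy (hvK y hyK)) hK.isClosed
  have hvc : HasCompactSupport v := hK.of_isClosed_subset (isClosed_tsupport _) hvs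
  have hmain := integral_mul_sq_le_integral_deriv_sq_of_contDiff_one hp h hv hvc (hvs.trans hKs)
  rw [← integral_Ioc_eq_integral_Ioo, ← integral_Ioc_eq_integral_Ioo,
    ← intervalIntegral.integral_of_le hle, ← intervalIntegral.integral_of_le hle] at hmain
  have hva : v a = 0 := by simp [v]
  have hvma : v (-a) = 0 := by simp [v]
  have hv'c : Continuous (deriv v) := hv.continuous_deriv le_rfl
  have hw'c : Continuous (deriv (deriv ω)) := hω'.continuous_deriv le_rfl
  have hparts := intervalIntegral.integral_mul_deriv_eq_deriv_mul (a := -a) (b := a)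
    (fun y _ ↦ (hv.differentiable one_ne_zero y).hasDerivAt)
    (fun y _ ↦ (hω'.differentiable one_ne_zero y).hasDerivAt)
    (hv'c.intervalIntegrable _ _) (hw'c.intervalIntegrable _ _)
  rw [hva, hvma] at hparts
  have hv' : ∀ y ∈ Ioo (-a) a, deriv v y = -(deriv G (δ - ω y) * deriv ω y) := fun y hy ↦ by
    rw [(hvu y hy).deriv_eq]
    have h1 := (hω.differentiable two_ne_zero y).hasDerivAt.const_sub δ
    have h2 := ((hG.differentiable one_ne_zero (δ - ω y)).hasDerivAt.comp y h1).deriv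
    rw [show u = G ∘ fun y ↦ δ - ω y from rfl, h2]
    ring
  have hsq : ∫ y in (-a)..a, deriv v y ^ 2 ≤ ∫ y in (-a)..a, -(deriv v y * deriv ω y) := by
    refine intervalIntegral.integral_mono_on_of_le_Ioo hle
      ((hv'c.pow 2).intervalIntegrable _ _)
      ((hv'c.mul hω'.continuous).neg.intervalIntegrable _ _) fun y hy ↦ ?_
    rw [hv' y hy]
    have := hG' (δ - ω y)
    nlinarith [mul_nonneg (mul_nonneg this.1 (sub_nonneg.2 this.2)) (sq_nonneg (deriv ω y))]
  rw [intervalIntegral.integral_neg] at hsq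
  have hvnn : ∀ y, 0 ≤ v y * (v y + ω y) := fun y ↦ by
    by_cases hy : y ∈ Ioo (-a) a
    · rw [show v y = G (δ - ω y) from indicator_of_mem hy _]
      rcases le_or_gt (δ - ω y) 0 with hs | hs
      · simp [hGz _ hs]
      · obtain ⟨h1, h2⟩ := hGp _ hs
        exact mul_nonneg h1.le (by linarith)
    · simp [v, hy]
  have hp1 : ContinuousOn (fun y ↦ p y * (v y * (v y + ω y))) (Icc (-a) a) :=
    hp.mul (hv.continuous.mul (hv.continuous.add hω.continuous)).continuousOn
  have hstrict : 0 < ∫ y in (-a)..a, p y * (v y * (v y + ω y)) := by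
    refine intervalIntegral.integral_pos (by linarith) hp1
      (fun y hy ↦ mul_nonneg (hp0 y (Ioc_subset_Icc_self hy)).le (hvnn y)) ⟨y₀, hy₀, ?_⟩
    refine mul_pos (hp0 y₀ hy₀) ?_
    rw [show v y₀ = G (δ - ω y₀) from indicator_of_mem hy₀' _]
    obtain ⟨h1, h2⟩ := hGp (δ - ω y₀) (by linarith)
    exact mul_pos h1 (by linarith)
  have hsum : ∫ y in (-a)..a, p y * (v y * (v y + ω y)) =
      (∫ y in (-a)..a, p y * v y ^ 2) - ∫ y in (-a)..a, v y * deriv (deriv ω) y := by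
    rw [← intervalIntegral.integral_sub]
    · refine intervalIntegral.integral_congr fun y hy ↦ ?_
      rw [uIcc_of_le hle] at hy
      linear_combination -v y * hωeq y hy
    · exact ContinuousOn.intervalIntegrable_of_Icc hle (hp.mul (hv.continuous.pow 2).continuousOn)
    · exact (hv.continuous.mul hw'c).intervalIntegrable _ _
  linarith

/-- A positive solution of `-ω'' = p ω` with `p` even and equal values at both end points is even. -/
theorem eq_reflection_of_neg_deriv_deriv_eq {a : ℝ} (ha : 0 < a) {p : ℝ → ℝ}
    (hpeven : ∀ y, p (-y) = p y) {ω : ℝ → ℝ} (hω : Differentiable ℝ ω)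
    (hω' : Differentiable ℝ (deriv ω))
    (hωeq : ∀ y ∈ Icc (-a) a, -(deriv (deriv ω) y) = p y * ω y)
    (hpos : ∀ y ∈ Icc (-a) a, 0 < ω y) (hωa : ω (-a) = ω a) :
    ∀ y ∈ Icc (-a) a, ω y = ω (-y) := by
  have hneg : ∀ {y}, y ∈ Icc (-a) a → -y ∈ Icc (-a) a := fun hy ↦
    ⟨neg_le_neg hy.2, neg_le.1 hy.1⟩
  have hz : ∀ y, HasDerivAt (fun y ↦ ω (-y)) (-deriv ω (-y)) y := fun y ↦ by
    simpa [Function.comp_def] using (hω (-y)).hasDerivAt.comp y (hasDerivAt_neg y)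
  have hz' : ∀ y, HasDerivAt (fun y ↦ -deriv ω (-y)) (deriv (deriv ω) (-y)) y := fun y ↦ by
    have := (hω' (-y)).hasDerivAt.comp y (hasDerivAt_neg y)
    simpa [Function.comp_def] using this.fun_neg
  let W : ℝ → ℝ := fun y ↦ -deriv ω (-y) * ω y - ω (-y) * deriv ω y
  have hW : ∀ y ∈ Icc (-a) a, HasDerivAt W 0 y := fun y hy ↦ by
    refine (((hz' y).mul (hω y).hasDerivAt).sub ((hz y).mul (hω' y).hasDerivAt)).congr_deriv ?_
    have h1 := hωeq y hy
    have h2 := hωeq (-y) (hneg hy)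
    rw [hpeven] at h2
    linear_combination ω (-y) * h1 - ω y * h2
  have hWconst := constant_of_has_deriv_right_zero
    (fun y hy ↦ (hW y hy).continuousAt.continuousWithinAt)
    (fun y hy ↦ (hW y (Ico_subset_Icc_self hy)).hasDerivWithinAt)
  let r : ℝ → ℝ := fun y ↦ ω (-y) / ω y
  have hr : ∀ y ∈ Icc (-a) a, HasDerivAt r (W y / ω y ^ 2) y := fun y hy ↦
    (hz y).div (hω y).hasDerivAt (hpos y hy).ne'
  have hrc : ContinuousOn r (Icc (-a) a) := fun y hy ↦ (hr y hy).continuousAt.continuousWithinAt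
  have hma : -a ∈ Icc (-a) a := ⟨le_rfl, by linarith⟩
  have hra : r (-a) = 1 := by
    simp only [r, neg_neg, hωa]
    exact div_self (hωa ▸ hpos _ hma).ne'
  have hra' : r a = 1 := by
    simp only [r, hωa]
    exact div_self (hωa ▸ hpos _ hma).ne'
  obtain ⟨c, hc, hc0⟩ := exists_hasDerivAt_eq_zero (by linarith : -a < a) hrc (hra.trans hra'.symm)
    (fun y hy ↦ hr y (Ioo_subset_Icc_self hy))
  have hc' := Ioo_subset_Icc_self hc
  have hWc : W c = 0 := by
    simpa [(hpos c hc').ne'] using hc0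
  have hW0 : ∀ y ∈ Icc (-a) a, W y = 0 := fun y hy ↦ by
    rw [hWconst y hy, ← hWconst c hc', hWc]
  have hrconst := constant_of_has_deriv_right_zero hrc fun y hy ↦ by
    have hy' := Ico_subset_Icc_self hy
    simpa [hW0 y hy'] using (hr y hy').hasDerivWithinAt (s := Ici y)
  intro y hy
  have := hrconst y hy
  rw [hra, div_eq_one_iff_eq (hpos y hy).ne'] at this
  exact this.symm

theorem statement2 (a : ℝ) (ha : 0 < a)
    (q : ℝ → ℝ) (hqc : ContinuousOn q (Icc (-a) a))
    (hqeven : ∀ y, q (-y) = q y)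
    (hqnonneg : ∀ y ∈ Icc (-a) a, 0 ≤ q y)
    (μ : ℝ) (hμ : 0 < μ)
    -- μ is below the first Dirichlet eigenvalue of −d²/dy² − q on (−a,a):
    (hspec : ∀ ξ : ℝ → ℝ, ContDiff ℝ (⊤ : ℕ∞) ξ → HasCompactSupport ξ →
      tsupport ξ ⊆ Ioo (-a) a → ξ ≠ 0 →
      (∫ y in Ioo (-a) a, (q y + μ) * (ξ y) ^ 2) < ∫ y in Ioo (-a) a, (deriv ξ y) ^ 2)
    (ω : ℝ → ℝ) (hω : ContDiff ℝ 2 ω)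
    (hωeq : ∀ y ∈ Ioo (-a) a, -(deriv (deriv ω) y) = (q y + μ) * ω y)
    (hωm : ω (-a) = 1) (hωp : ω a = 1) :
    -- (i) positivity
    (∀ y ∈ Icc (-a) a, 0 < ω y) ∧
    -- (ii) evenness
    (∀ y ∈ Icc (-a) a, ω y = ω (-y)) ∧
    -- (iii) strict concavity, maximum at 0, and y·ω'(y) < 0 for y ≠ 0
    (∀ y ∈ Icc (-a) a, deriv (deriv ω) y < 0) ∧
    IsMaxOn ω (Icc (-a) a) 0 ∧
    (∀ y ∈ Icc (-a) a, y ≠ 0 → y * deriv ω y < 0) := by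
  have hle : -a < a := by linarith
  have hω' : ContDiff ℝ 1 (deriv ω) := by
    rw [← one_add_one_eq_two, contDiff_succ_iff_deriv] at hω
    exact hω.2.2
  have hd := hω.differentiable two_ne_zero
  have hd' := hω'.differentiable one_ne_zero
  have hp : ContinuousOn (fun y ↦ q y + μ) (Icc (-a) a) := hqc.add continuousOn_const
  have hp0 : ∀ y ∈ Icc (-a) a, 0 < q y + μ := fun y hy ↦ by linarith [hqnonneg y hy]
  have heq : ∀ y ∈ Icc (-a) a, -(deriv (deriv ω) y) = (q y + μ) * ω y := by
    have h := EqOn.of_subset_closure (s := Ioo (-a) a) (t := Icc (-a) a) hωeq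
      (hω'.continuous_deriv le_rfl).neg.continuousOn (hp.mul hω.continuous.continuousOn)
      Ioo_subset_Icc_self (closure_Ioo hle.ne).superset
    exact h
  have hspec' : ∀ ξ : ℝ → ℝ, ContDiff ℝ (⊤ : ℕ∞) ξ → HasCompactSupport ξ →
      tsupport ξ ⊆ Ioo (-a) a →
      (∫ y in Ioo (-a) a, (q y + μ) * (ξ y) ^ 2) ≤ ∫ y in Ioo (-a) a, (deriv ξ y) ^ 2 := by
    intro ξ h1 h2 h3
    by_cases h0 : ξ = 0
    · subst h0
      simp
    · exact (hspec ξ h1 h2 h3 h0).le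
  have hpos : ∀ y ∈ Icc (-a) a, 0 < ω y := fun y hy ↦ one_pos.trans_le
    (one_le_of_neg_deriv_deriv_eq ha hp hp0 hspec' hω heq hωm hωp y hy)
  have heven := eq_reflection_of_neg_deriv_deriv_eq ha (p := fun y ↦ q y + μ)
    (fun y ↦ by rw [hqeven]) hd hd' heq hpos (hωm.trans hωp.symm)
  have hconc : ∀ y ∈ Icc (-a) a, deriv (deriv ω) y < 0 := fun y hy ↦ by
    linarith [heq y hy, mul_pos (hp0 y hy) (hpos y hy)]
  have h0 : (0 : ℝ) ∈ Icc (-a) a := ⟨by linarith, ha.le⟩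
  have hd0 : deriv ω 0 = 0 := by
    have h1 : ω =ᶠ[𝓝 0] fun y ↦ ω (-y) := by
      filter_upwards [Icc_mem_nhds (by linarith : -a < 0) ha] with y hy using heven y hy
    have h2 := h1.deriv_eq
    rw [deriv_comp_neg, neg_zero] at h2
    linarith
  have hanti : StrictAntiOn (deriv ω) (Icc (-a) a) :=
    strictAntiOn_of_deriv_neg (convex_Icc _ _) hω'.continuous.continuousOn
      fun y hy ↦ hconc y (interior_subset hy)
  refine ⟨hpos, heven, hconc, ?_, fun y hy hy0 ↦ ?_⟩
  · have hc : ConcaveOn ℝ (Icc (-a) a) ω :=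
      hanti.antitoneOn.mono interior_subset |>.concaveOn_of_deriv (convex_Icc _ _)
        hω.continuous.continuousOn hd.differentiableOn
    exact IsMaxOn.of_isLocalMaxOn_of_concaveOn h0
      ((isLocalMax_of_deriv_deriv_neg (hconc 0 h0) hd0 hω.continuous.continuousAt).on _) hc
  · rcases hy0.lt_or_gt with hlt | hgt
    · exact mul_neg_of_neg_of_pos hlt (hd0 ▸ hanti hy h0 hlt)
    · exact mul_neg_of_pos_of_neg hgt (hd0 ▸ hanti h0 hy hgt)
end
end

section
/- Let N ≥ 2, k ≥ 1, 0 < t₁ < … < t_k, v(t,s) = Re( −∏_{ℓ=1}^k ((t+is) − t_ℓ)((t+is) + t_ℓ) ), u_ε(x,y) = (1/2)(N − |y|²) + ε Σ_{j=1}^N v(x,y_j), and Ω_ε the connected component of {u_ε > 0} containing the origin. Then there exists ε₀ > 0 such that for all ε ∈ (0,ε₀), x ∂_x u_ε(x,y) + Σ_{j=1}^N y_j ∂_{y_j} u_ε(x,y) ≤ −N/2 for every (x,y) ∈ ∂Ω_ε. Consequently Ω_ε is star-shaped with respect to the origin (for every p ∈ Ω_ε and t ∈ (0,1], t·p ∈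 Ω_ε) and ∂Ω_ε is a smooth hypersurface. -/
open MeasureTheory Set Filter Topology

noncomputable section

/-- `v(t,s) = Re( −∏_ℓ ((t+is) − t_ℓ)((t+is) + t_ℓ) )`. -/
def vfun (k : ℕ) (t : Fin k → ℝ) (a s : ℝ) : ℝ :=
  (-∏ l : Fin k, ((((a : ℂ) + (s : ℂ) * Complex.I) - (t l : ℂ)) *
      (((a : ℂ) + (s : ℂ) * Complex.I) + (t l : ℂ)))).re

/-- `u_ε(x,y) = (1/2)(N − |y|²) + ε Σ_j v(x, y_j)`. -/
def ueps (N k : ℕ) (t : Fin k → ℝ) (ε : ℝ) (p : Pt N) : ℝ :=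
  (1 / 2) * ((N : ℝ) - ∑ j, (p.2 j) ^ 2) + ε * ∑ j, vfun k t p.1 (p.2 j)

/-- `Ω_ε`: the connected component of `{u_ε > 0}` containing the origin. -/
def OmT (N k : ℕ) (t : Fin k → ℝ) (ε : ℝ) : Set (Pt N) :=
  connectedComponentIn {p : Pt N | 0 < ueps N k t ε p} 0

/-- A finite product of factors `z² - c²` has, far out in a horizontal strip, positive real part
and an imaginary part that is small compared with it. -/
theorem prod_re_pos_of_large {ι : Type*} (s : Finset ι) (c : ι → ℝ) (M : ℝ) (hM : 0 ≤ M) :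
    ∃ X > (0:ℝ), ∃ K ≥ (0:ℝ), ∀ a b : ℝ, |b| ≤ M → X ≤ |a| →
      0 < (∏ l ∈ s, (((a : ℂ) + b * Complex.I) ^ 2 - (c l : ℂ) ^ 2)).re ∧
      |a| * |(∏ l ∈ s, (((a : ℂ) + b * Complex.I) ^ 2 - (c l : ℂ) ^ 2)).im| ≤
        K * (∏ l ∈ s, (((a : ℂ) + b * Complex.I) ^ 2 - (c l : ℂ) ^ 2)).re := by
  classical
  induction s using Finset.induction_on with
  | empty => exact ⟨1, one_pos, 0, le_rfl, fun a b _ _ => by simp⟩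
  | insert i s hi ih =>
    obtain ⟨X, hX, K, hK, h⟩ := ih
    set Y := 1 + 2 * (M ^ 2 + c i ^ 2) with hY
    refine ⟨max (max X Y) (1 + 8 * M * K), by positivity, 2 * (K + 4 * M), by positivity,
      fun a b hb ha => ?_⟩
    obtain ⟨hXY, ha3⟩ := max_le_iff.1 ha
    obtain ⟨ha1, ha2⟩ := max_le_iff.1 hXY
    obtain ⟨hre, him⟩ := h a b hb ha1
    rw [Finset.prod_insert hi]
    set w := ∏ l ∈ s, (((a : ℂ) + b * Complex.I) ^ 2 - (c l : ℂ) ^ 2)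
    set d := ((a : ℂ) + b * Complex.I) ^ 2 - (c i : ℂ) ^ 2 with hd
    have hdre : d.re = a ^ 2 - b ^ 2 - c i ^ 2 := by
      simp [hd, pow_two]
    have hdim : d.im = 2 * a * b := by
      simp [hd, pow_two]; ring
    have hA1 : 1 ≤ |a| := le_trans (by rw [hY]; nlinarith [sq_nonneg M, sq_nonneg (c i)]) ha2
    have hb2 : b ^ 2 ≤ M ^ 2 := sq_le_sq' (neg_le_of_abs_le hb) (le_of_abs_le hb)
    have hsq : |a| ^ 2 = a ^ 2 := sq_abs a
    have hdre2 : |a| ^ 2 / 2 ≤ d.re := by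
      rw [hdre]; nlinarith [sq_nonneg M, sq_nonneg (c i)]
    have hdpos : 0 < d.re := lt_of_lt_of_le (by positivity) hdre2
    have hdim2 : |a| * |d.im| ≤ 4 * M * d.re := by
      have : |d.im| = 2 * |a| * |b| := by rw [hdim, abs_mul, abs_mul]; simp
      rw [this]
      have h1 : |a| * (2 * |a| * |b|) ≤ 2 * |a| ^ 2 * M := by
        have := mul_le_mul_of_nonneg_left hb (by positivity : 0 ≤ 2 * |a| ^ 2)
        linarith
      have := mul_le_mul_of_nonneg_left hdre2 (by positivity : 0 ≤ 4 * M)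
      linarith
    have hprod : |a| * |a| * (|d.im| * |w.im|) ≤ 4 * M * K * (d.re * w.re) := by
      have := mul_le_mul hdim2 him (by positivity) (by positivity)
      linarith
    have hcross : 2 * (|d.im| * |w.im|) ≤ d.re * w.re := by
      have hP : 0 < d.re * w.re := mul_pos hdpos hre
      have h1 : 8 * M * K ≤ |a| * |a| := by nlinarith
      have h2 : |a| * |a| * (2 * (|d.im| * |w.im|)) ≤ |a| * |a| * (d.re * w.re) := by
        have := mul_le_mul_of_nonneg_right h1 hP.le
        linarith
      exact le_of_mul_le_mul_left h2 (by positivity)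
    have habs : d.im * w.im ≤ |d.im| * |w.im| := by rw [← abs_mul]; exact le_abs_self _
    have hP : 0 < d.re * w.re := mul_pos hdpos hre
    rw [Complex.mul_re, Complex.mul_im]
    refine ⟨by linarith, ?_⟩
    have h3 : |d.re * w.im + d.im * w.re| ≤ d.re * |w.im| + |d.im| * w.re := by
      refine (abs_add_le _ _).trans_eq ?_
      rw [abs_mul, abs_mul, abs_of_pos hdpos, abs_of_pos hre]
    have h4 : |a| * |d.re * w.im + d.im * w.re| ≤ (K + 4 * M) * (d.re * w.re) := by
      have e1 := mul_le_mul_of_nonneg_left h3 (abs_nonneg a)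
      have e2 := mul_le_mul_of_nonneg_left him hdpos.le
      have e3 := mul_le_mul_of_nonneg_right hdim2 hre.le
      linarith
    have h5 : d.re * w.re ≤ 2 * (d.re * w.re - d.im * w.im) := by linarith
    have := mul_le_mul_of_nonneg_left h5 (by positivity : 0 ≤ K + 4 * M)
    linarith

/-- The real part of a finite product of factors `z² - c²` is bounded below on horizontal
strips. -/
theorem exists_neg_prod_re_le {ι : Type*} (s : Finset ι) (c : ι → ℝ) (M : ℝ) (hM : 0 ≤ M) :
    ∃ C ≥ (0:ℝ), ∀ a b : ℝ, |b| ≤ M →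
      -(∏ l ∈ s, (((a : ℂ) + b * Complex.I) ^ 2 - (c l : ℂ) ^ 2)).re ≤ C := by
  obtain ⟨X, hX, K, -, h⟩ := prod_re_pos_of_large s c M hM
  have hcont : Continuous fun q : ℝ × ℝ =>
      -(∏ l ∈ s, (((q.1 : ℂ) + q.2 * Complex.I) ^ 2 - (c l : ℂ) ^ 2)).re := by fun_prop
  obtain ⟨C, hC⟩ := ((isCompact_Icc (a := -X) (b := X)).prod
    (isCompact_Icc (a := -M) (b := M))).bddAbove_image hcont.continuousOn
  refine ⟨max C 0, le_max_right _ _, fun a b hb => ?_⟩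
  by_cases ha : X ≤ |a|
  · exact le_trans (by linarith [(h a b hb ha).1]) (le_max_right _ _)
  · exact le_trans (hC ⟨(a, b), ⟨abs_le.1 (not_le.1 ha).le, abs_le.1 hb⟩, rfl⟩) (le_max_left _ _)

theorem vfun_eq (k : ℕ) (t : Fin k → ℝ) (a s : ℝ) :
    vfun k t a s = -(∏ l, (((a : ℂ) + s * Complex.I) ^ 2 - (t l : ℂ) ^ 2)).re := by
  rw [vfun, Complex.neg_re]
  congr 2
  exact Finset.prod_congr rfl fun l _ => by ring

/-- The Euler (radial) derivative of `vfun`. -/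
def vfunEuler (k : ℕ) (t : Fin k → ℝ) (a s : ℝ) : ℝ :=
  -(∑ l, (∏ m ∈ Finset.univ.erase l, (((a : ℂ) + s * Complex.I) ^ 2 - (t m : ℂ) ^ 2)) *
    (2 * ((a : ℂ) + s * Complex.I) ^ 2)).re

theorem hasDerivAt_vfun_smul (k : ℕ) (t : Fin k → ℝ) (a s : ℝ) :
    HasDerivAt (fun r : ℝ => vfun k t (r * a) (r * s)) (vfunEuler k t a s) 1 := by
  have hf : ∀ l ∈ (Finset.univ : Finset (Fin k)), HasDerivAt
      (fun r : ℝ => (r : ℂ) ^ 2 * ((a : ℂ) + s * Complex.I) ^ 2 - (t l : ℂ) ^ 2)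
      (2 * ((a : ℂ) + s * Complex.I) ^ 2) 1 := fun l _ => by
    have h := (((hasDerivAt_id (1:ℝ)).ofReal_comp.pow 2).mul_const
      (((a : ℂ) + s * Complex.I) ^ 2)).sub_const ((t l : ℂ) ^ 2)
    exact h.congr_deriv (by simp)
  have h := HasDerivAt.fun_finsetProd hf
  have h2 := (Complex.reCLM.hasFDerivAt.comp_hasDerivAt (1:ℝ) h).neg
  refine (h2.congr_deriv ?_).congr_of_eventuallyEq (.of_forall fun r => ?_)
  · simp [vfunEuler, smul_eq_mul]
  · simp only [vfun_eq, Pi.neg_apply, Function.comp_apply, Complex.reCLM_apply]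
    congr 2
    exact Finset.prod_congr rfl fun l _ => by push_cast; ring

/-- `vfun` is bounded above on horizontal strips. -/
theorem exists_vfun_le (k : ℕ) (t : Fin k → ℝ) (M : ℝ) (hM : 0 ≤ M) :
    ∃ C ≥ (0:ℝ), ∀ a s : ℝ, |s| ≤ M → vfun k t a s ≤ C := by
  simpa only [vfun_eq] using exists_neg_prod_re_le Finset.univ t M hM

/-- On horizontal strips the Euler derivative of `vfun` exceeds `2 * vfun` by at most a constant. -/
theorem exists_vfunEuler_sub_le (k : ℕ) (hk : 1 ≤ k) (t : Fin k → ℝ) (M : ℝ) (hM : 0 ≤ M) :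
    ∃ C ≥ (0:ℝ), ∀ a s : ℝ, |s| ≤ M → vfunEuler k t a s - 2 * vfun k t a s ≤ C := by
  let i : Fin k := ⟨0, hk⟩
  obtain ⟨C₁, hC₁, h₁⟩ := exists_neg_prod_re_le (Finset.univ.erase i) t M hM
  have h2 : ∀ l : Fin k, ∃ C ≥ (0:ℝ), ∀ a s : ℝ, |s| ≤ M →
      -((∏ m ∈ Finset.univ.erase l, (((a : ℂ) + s * Complex.I) ^ 2 - (t m : ℂ) ^ 2)) *
        ((a : ℂ) + s * Complex.I) ^ 2).re ≤ C := fun l => by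
    obtain ⟨C, hC, h⟩ := exists_neg_prod_re_le Finset.univ (Function.update t l 0) M hM
    refine ⟨C, hC, fun a s hs => le_trans (le_of_eq ?_) (h a s hs)⟩
    rw [← Finset.prod_erase_mul _ _ (Finset.mem_univ l)]
    congr 3
    · refine Finset.prod_congr rfl fun m hm => ?_
      rw [Function.update_of_ne (Finset.ne_of_mem_erase hm)]
    · simp
  choose C hC h using h2
  refine ⟨2 * t i ^ 2 * C₁ + 2 * ∑ l ∈ Finset.univ.erase i, C l,
    add_nonneg (by positivity) (mul_nonneg two_pos.le (Finset.sum_nonneg fun l _ => hC l)),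
    fun a s hs => ?_⟩
  have key : vfunEuler k t a s - 2 * vfun k t a s =
      2 * t i ^ 2 *
        -(∏ m ∈ Finset.univ.erase i, (((a : ℂ) + s * Complex.I) ^ 2 - (t m : ℂ) ^ 2)).re +
      2 * ∑ l ∈ Finset.univ.erase i,
        -((∏ m ∈ Finset.univ.erase l, (((a : ℂ) + s * Complex.I) ^ 2 - (t m : ℂ) ^ 2)) *
          ((a : ℂ) + s * Complex.I) ^ 2).re := by
    rw [vfunEuler, vfun_eq, ← Finset.sum_erase_add _ _ (Finset.mem_univ i),
      ← Finset.prod_erase_mul _ _ (Finset.mem_univ i)]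
    generalize (∏ m ∈ Finset.univ.erase i, (((a : ℂ) + s * Complex.I) ^ 2 - (t m : ℂ) ^ 2)) = P
    generalize ((a : ℂ) + s * Complex.I) ^ 2 = w
    have e : (∑ l ∈ Finset.univ.erase i,
        (∏ m ∈ Finset.univ.erase l, (w - (t m : ℂ) ^ 2)) * (2 * w)).re =
        2 * ∑ l ∈ Finset.univ.erase i,
          ((∏ m ∈ Finset.univ.erase l, (w - (t m : ℂ) ^ 2)) * w).re := by
      rw [Complex.re_sum, Finset.mul_sum]
      refine Finset.sum_congr rfl fun l _ => ?_
      rw [mul_left_comm]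
      simp [Complex.mul_re]
    rw [Complex.add_re, e, Finset.sum_neg_distrib]
    simp [Complex.mul_re, pow_two]
    ring
  rw [key]
  gcongr with l hl
  · exact h₁ a s hs
  · exact h l a s hs

theorem contDiff_ueps (N k : ℕ) (t : Fin k → ℝ) (ε : ℝ) :
    ContDiff ℝ (⊤ : ℕ∞) (ueps N k t ε) := by
  have hv : ∀ j : Fin N, ContDiff ℝ (⊤ : ℕ∞) fun p : Pt N => vfun k t p.1 (p.2 j) := fun j => by
    have h1 : ContDiff ℝ (⊤ : ℕ∞) fun p : Pt N => (p.1 : ℂ) :=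
      Complex.ofRealCLM.contDiff.comp contDiff_fst
    have h2 : ContDiff ℝ (⊤ : ℕ∞) fun p : Pt N => (p.2 j : ℂ) :=
      Complex.ofRealCLM.contDiff.comp (by fun_prop : ContDiff ℝ (⊤ : ℕ∞) fun p : Pt N => p.2 j)
    have h3 := h1.add (h2.mul (contDiff_const (c := Complex.I)))
    exact Complex.reCLM.contDiff.comp (contDiff_prod fun l _ =>
      (h3.sub (contDiff_const (c := (t l : ℂ)))).mul (h3.add (contDiff_const (c := (t l : ℂ))))).neg
  unfold ueps
  fun_prop

/-- The radial derivative of `ueps`. -/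
theorem fderiv_ueps_self (N k : ℕ) (t : Fin k → ℝ) (ε : ℝ) (p : Pt N) :
    fderiv ℝ (ueps N k t ε) p p =
      -∑ j, p.2 j ^ 2 + ε * ∑ j, vfunEuler k t p.1 (p.2 j) := by
  have hd : DifferentiableAt ℝ (ueps N k t ε) ((1:ℝ) • p) :=
    (contDiff_ueps N k t ε).differentiable (by simp) _
  have h1 : HasDerivAt (fun r : ℝ => r • p) p 1 := by
    simpa using (hasDerivAt_id (1:ℝ)).smul_const p
  have h2 := hd.hasFDerivAt.comp_hasDerivAt (1:ℝ) h1
  have h3 : HasDerivAt (fun r : ℝ => ueps N k t ε (r • p))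
      (-∑ j, p.2 j ^ 2 + ε * ∑ j, vfunEuler k t p.1 (p.2 j)) 1 := by
    have hs : HasDerivAt (fun r : ℝ => (1 / 2) * ((N : ℝ) - r ^ 2 * ∑ j, p.2 j ^ 2))
        (-∑ j, p.2 j ^ 2) 1 := by
      exact ((((hasDerivAt_pow 2 (1:ℝ)).mul_const (∑ j, p.2 j ^ 2)).const_sub
        (N : ℝ)).const_mul (1 / 2)).congr_deriv (by simp)
    have hv := (HasDerivAt.fun_sum (u := (Finset.univ : Finset (Fin N))) fun j _ =>
      hasDerivAt_vfun_smul k t p.1 (p.2 j)).const_mul ε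
    refine (hs.add hv).congr_of_eventuallyEq (.of_forall fun r => ?_)
    simp [ueps, mul_pow, Finset.mul_sum]
  have := h2.unique h3
  rwa [one_smul] at this

theorem fderiv_coord_sum (N : ℕ) (L : Pt N →L[ℝ] ℝ) (p : Pt N) :
    p.1 * L (1, 0) + ∑ j, p.2 j * L (0, Pi.single j 1) = L p := by
  have hp : p = p.1 • ((1, 0) : Pt N) + ∑ j, p.2 j • ((0, Pi.single j 1) : Pt N) := by
    refine Prod.ext ?_ ?_
    · simp [Prod.fst_sum]
    · funext m
      simp [Prod.snd_sum, Finset.sum_apply, Pi.single_apply]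
  conv_rhs => rw [hp]
  simp only [map_add, map_sum, map_smul, smul_eq_mul]

/-- If `f` satisfies the differential inequality `D f q q ≤ 2 f q` along a ray, then
`f (r • p) ≥ r² f p` for `0 < r ≤ 1`. -/
theorem sq_mul_le_of_fderiv_self_le {E : Type*} [NormedAddCommGroup E] [NormedSpace ℝ E]
    {f : E → ℝ} (hf : Differentiable ℝ f) {p : E}
    (h : ∀ r ∈ Ioc (0:ℝ) 1, fderiv ℝ f (r • p) (r • p) ≤ 2 * f (r • p)) {r : ℝ}
    (hr : r ∈ Ioc (0:ℝ) 1) : r ^ 2 * f p ≤ f (r • p) := by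
  have hd : ∀ x : ℝ, 0 < x → HasDerivAt (fun r : ℝ => f (r • p) / r ^ 2)
      ((fderiv ℝ f (x • p) p * x ^ 2 - f (x • p) * (2 * x)) / (x ^ 2) ^ 2) x := fun x hx => by
    have h1 : HasDerivAt (fun r : ℝ => r • p) p x := by
      simpa using (hasDerivAt_id x).smul_const p
    have h2 := (hf (x • p)).hasFDerivAt.comp_hasDerivAt x h1
    have h3 := h2.div (hasDerivAt_pow 2 x) (by positivity)
    exact h3.congr_deriv (by simp)
  have hanti : AntitoneOn (fun r : ℝ => f (r • p) / r ^ 2) (Ioc 0 1) := by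
    refine antitoneOn_of_deriv_nonpos (convex_Ioc 0 1)
      (fun x hx => (hd x hx.1).continuousAt.continuousWithinAt)
      (fun x hx => (hd x (interior_subset hx).1).differentiableAt.differentiableWithinAt)
      fun x hx => ?_
    have hx' := interior_subset hx
    rw [(hd x hx'.1).deriv]
    refine div_nonpos_of_nonpos_of_nonneg ?_ (by positivity)
    have := h x hx'
    rw [map_smul, smul_eq_mul] at this
    nlinarith [mul_le_mul_of_nonneg_left this hx'.1.le]
  have := hanti hr (right_mem_Ioc.2 one_pos) hr.2
  simp only [one_smul, one_pow, div_one] at this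
  rw [le_div_iff₀ (pow_pos hr.1 2)] at this
  linarith

/-- For small `ε`, the function `ueps` is positive at the origin, negative on the boundary of the
cylinder `|y|² < 2N`, and satisfies a strict Euler inequality on the closed cylinder. -/
theorem exists_ueps_bounds (N : ℕ) (hN : 2 ≤ N) (k : ℕ) (hk : 1 ≤ k) (t : Fin k → ℝ) :
    ∃ ε₀ > (0:ℝ), ∀ ε ∈ Ioo (0:ℝ) ε₀, 0 < ueps N k t ε 0 ∧
      (∀ p : Pt N, ∑ j, p.2 j ^ 2 = 2 * N → ueps N k t ε p < 0) ∧
      (∀ p : Pt N, ∑ j, p.2 j ^ 2 ≤ 2 * N →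
        fderiv ℝ (ueps N k t ε) p p ≤ 2 * ueps N k t ε p - N / 2) := by
  obtain ⟨C₁, hC₁, h₁⟩ := exists_vfun_le k t (2 * N) (by positivity)
  obtain ⟨C₂, hC₂, h₂⟩ := exists_vfunEuler_sub_le k hk t (2 * N) (by positivity)
  have hN0 : (2:ℝ) ≤ N := by exact_mod_cast hN
  set D := C₁ + C₂ + |vfun k t 0 0| + 1 with hD
  have hDpos : 0 < D := by positivity
  refine ⟨1 / (2 * D), by positivity, fun ε hε => ?_⟩
  have hεD : ε * D < 1 / 2 := by
    have := hε.2
    rw [lt_div_iff₀ (by positivity)] at this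
    linarith
  have hsum : ∀ f : Fin N → ℝ, (∀ j, f j ≤ D) → ε * ∑ j, f j < N / 2 := fun f hf => by
    have h3 : ∑ j, f j ≤ N * D := by
      simpa using Finset.sum_le_sum (s := Finset.univ) fun j _ => hf j
    nlinarith [mul_le_mul_of_nonneg_left h3 hε.1.le]
  have hcoord : ∀ p : Pt N, ∑ j, p.2 j ^ 2 ≤ 2 * N → ∀ j, |p.2 j| ≤ 2 * N := fun p hp j => by
    have h3 : p.2 j ^ 2 ≤ 2 * N :=
      (Finset.single_le_sum (f := fun j => p.2 j ^ 2) (fun _ _ => sq_nonneg _)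
        (Finset.mem_univ j)).trans hp
    exact abs_le_of_sq_le_sq (by nlinarith) (by positivity)
  have hv0 := abs_nonneg (vfun k t 0 0)
  refine ⟨?_, fun p hp => ?_, fun p hp => ?_⟩
  · have := hsum (fun _ => -vfun k t 0 0) fun _ => by linarith [neg_le_abs (vfun k t 0 0)]
    simp only [Finset.sum_neg_distrib] at this
    simp only [ueps, Prod.fst_zero, Prod.snd_zero, Pi.zero_apply]
    simp only [ne_eq, OfNat.ofNat_ne_zero, not_false_eq_true, zero_pow, Finset.sum_const_zero]
    linarith
  · have := hsum (fun j => vfun k t p.1 (p.2 j)) fun j => by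
      linarith [h₁ p.1 (p.2 j) (hcoord p hp.le j)]
    rw [ueps, hp]
    linarith
  · have := hsum (fun j => vfunEuler k t p.1 (p.2 j) - 2 * vfun k t p.1 (p.2 j)) fun j => by
      linarith [h₂ p.1 (p.2 j) (hcoord p hp j)]
    rw [Finset.sum_sub_distrib, ← Finset.mul_sum] at this
    rw [fderiv_ueps_self, ueps]
    linarith

theorem statement14 (N : ℕ) (hN : 2 ≤ N) (k : ℕ) (hk : 1 ≤ k)
    (t : Fin k → ℝ) (ht : StrictMono t) (htpos : ∀ i, 0 < t i) :
    ∃ ε₀ > (0:ℝ), ∀ ε ∈ Ioo (0:ℝ) ε₀,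
      -- the radial derivative of u_ε is ≤ −N/2 on ∂Ω_ε
      (∀ p ∈ frontier (OmT N k t ε),
        p.1 * fderiv ℝ (ueps N k t ε) p (1, 0) +
          (∑ j, p.2 j * fderiv ℝ (ueps N k t ε) p (0, Pi.single j 1)) ≤ -(N : ℝ) / 2) ∧
      -- consequently Ω_ε is star-shaped with respect to the origin
      (∀ p ∈ OmT N k t ε, ∀ s ∈ Ioc (0:ℝ) 1, s • p ∈ OmT N k t ε) ∧
      -- and ∂Ω_ε is a smooth hypersurface: locally a regular level set of a smooth function
      (∀ p ∈ frontier (OmT N k t ε), ∃ F : Pt N → ℝ,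
        ContDiffAt ℝ (⊤ : ℕ∞) F p ∧ fderiv ℝ F p ≠ 0 ∧
        ∀ᶠ q in nhds p, (q ∈ OmT N k t ε ↔ F q < 0)) := by
  obtain ⟨ε₀, hε₀, H⟩ := exists_ueps_bounds N hN k hk t
  refine ⟨ε₀, hε₀, fun ε hε => ?_⟩
  obtain ⟨h0, hbd, hrad⟩ := H ε hε
  have hNpos : (0:ℝ) < N := by exact_mod_cast (by omega : 0 < N)
  have hsmooth := contDiff_ueps N k t ε
  have hucont : Continuous (ueps N k t ε) := hsmooth.continuous
  have hqcont : Continuous fun p : Pt N => ∑ j, p.2 j ^ 2 := by fun_prop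
  have hscale : ∀ p : Pt N, ∀ r : ℝ, ∑ j, (r • p).2 j ^ 2 = r ^ 2 * ∑ j, p.2 j ^ 2 := fun p r => by
    simp [mul_pow, Finset.mul_sum]
  have hstar : ∀ p : Pt N, ∑ j, p.2 j ^ 2 < 2 * N → 0 < ueps N k t ε p →
      ∀ r ∈ Ioc (0:ℝ) 1, ∑ j, (r • p).2 j ^ 2 < 2 * N ∧ 0 < ueps N k t ε (r • p) := by
    intro p hp hup r hr
    have hle : ∀ r ∈ Ioc (0:ℝ) 1, ∑ j, (r • p).2 j ^ 2 < 2 * N := fun r hr => by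
      rw [hscale]
      have hS : 0 ≤ ∑ j, p.2 j ^ 2 := Finset.sum_nonneg fun _ _ => sq_nonneg _
      exact (mul_le_of_le_one_left hS (pow_le_one₀ hr.1.le hr.2)).trans_lt hp
    refine ⟨hle r hr, lt_of_lt_of_le (mul_pos (pow_pos hr.1 2) hup)
      (sq_mul_le_of_fderiv_self_le (hsmooth.differentiable (by simp)) (fun s hs => ?_) hr)⟩
    linarith [hrad (s • p) (hle s hs).le]
  have hmem : ∀ p : Pt N, p ∈ OmT N k t ε ↔ ∑ j, p.2 j ^ 2 < 2 * N ∧ 0 < ueps N k t ε p := by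
    intro p
    have h0mem : (0 : Pt N) ∈ OmT N k t ε := mem_connectedComponentIn h0
    have hpos : OmT N k t ε ⊆ {p : Pt N | 0 < ueps N k t ε p} := connectedComponentIn_subset _ _
    constructor
    · intro hp
      refine ⟨?_, hpos hp⟩
      by_contra! hge
      obtain ⟨q, hq, hq2⟩ := isPreconnected_connectedComponentIn.intermediate_value h0mem hp
        hqcont.continuousOn (show (2 * N : ℝ) ∈ Icc _ _ from ⟨by simp, hge⟩)
      exact lt_asymm (hbd q hq2) (hpos hq)
    · rintro ⟨hp, hup⟩
      have hseg : IsPreconnected ((fun r : ℝ => r • p) '' Icc 0 1) :=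
        isPreconnected_Icc.image _ (by fun_prop)
      refine hseg.subset_connectedComponentIn ⟨0, by simp, by simp⟩ ?_ ⟨1, by simp, by simp⟩
      rintro _ ⟨r, hr, rfl⟩
      rcases hr.1.eq_or_lt with rfl | hr0
      · simpa using h0
      · exact (hstar p hp hup r ⟨hr0, hr.2⟩).2
  have hfr : ∀ p ∈ frontier (OmT N k t ε), ∑ j, p.2 j ^ 2 < 2 * N ∧ ueps N k t ε p = 0 := by
    intro p hp
    have hset : OmT N k t ε =
        {p | ∑ j, p.2 j ^ 2 < (2 * N : ℝ)} ∩ {p | 0 < ueps N k t ε p} :=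
      Set.ext hmem
    have hopen : IsOpen (OmT N k t ε) := hset ▸
      (isOpen_lt hqcont continuous_const).inter (isOpen_lt continuous_const hucont)
    rw [hopen.frontier_eq] at hp
    have hsub : OmT N k t ε ⊆ {p | ∑ j, p.2 j ^ 2 ≤ (2 * N : ℝ)} ∩ {p | 0 ≤ ueps N k t ε p} :=
      fun q hq => ⟨((hmem q).1 hq).1.le, ((hmem q).1 hq).2.le⟩
    obtain ⟨hp1, hp2⟩ := closure_minimal hsub ((isClosed_le hqcont continuous_const).inter
      (isClosed_le continuous_const hucont)) hp.1
    have hlt : ∑ j, p.2 j ^ 2 < 2 * N :=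
      lt_of_le_of_ne hp1 fun h => absurd (hbd p h) (not_lt.2 hp2)
    exact ⟨hlt, le_antisymm (not_lt.1 fun h => hp.2 ((hmem p).2 ⟨hlt, h⟩)) hp2⟩
  have hrad0 : ∀ p ∈ frontier (OmT N k t ε), fderiv ℝ (ueps N k t ε) p p ≤ -(N : ℝ) / 2 :=
    fun p hp => by linarith [hrad p (hfr p hp).1.le, (hfr p hp).2]
  refine ⟨fun p hp => ?_, fun p hp s hs => ?_, fun p hp => ?_⟩
  · rw [fderiv_coord_sum]
    exact hrad0 p hp
  · obtain ⟨h1, h2⟩ := (hmem p).1 hp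
    exact (hmem _).2 (hstar p h1 h2 s hs)
  · refine ⟨fun q => -ueps N k t ε q, hsmooth.neg.contDiffAt, fun h => ?_, ?_⟩
    · have h1 := hrad0 p hp
      rw [fderiv_fun_neg, neg_eq_zero] at h
      rw [h, zero_apply] at h1
      linarith
    · filter_upwards [(isOpen_lt hqcont continuous_const).mem_nhds (hfr p hp).1] with q hq
      rw [hmem, neg_lt_zero]
      exact and_iff_right hq
end
end

section
/- Let N ≥ 2, k ≥ 1, 0 < t₁ < … < t_k, v(t,s) = Re( −∏_{ℓ=1}^k ((t+is) − t_ℓ)((t+is) + t_ℓ) ), u_ε(x,y) = (1/2)(N − |y|²) + ε Σ_{j=1}^N v(x,y_j), and Ω_ε the connected component of {u_ε > 0} containing the origin. Then there exists ε₀ > 0 such that for all ε ∈ (0,ε₀) and every boundary point p ∈ ∂Ω_ε, the gradient ∇u_ε(p) is nonzero and the mean curvature of ∂Ω_ε at p, K_m(p) = −(1/(N |∇u_ε(p)|³)) · [ Σ_{j=1}^N ( (∂_x u_ε)² ∂_{y_j y_j} u_ε − 2 (∂_x u_ε)(∂_{y_j} u_ε)(∂_{x y_j} u_ε) + (∂_{y_j}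 u_ε)² ∂_{xx} u_ε ) + Σ_{j=1}^N (∂_{y_j} u_ε)² Σ_{ℓ ≠ j} ∂_{y_ℓ y_ℓ} u_ε ] evaluated at p, is strictly positive. -/
open MeasureTheory Set Filter Topology

noncomputable section

namespace LevelSetCurvature

open Polynomial

/-- The real polynomial `−∏_ℓ (X − t_ℓ)(X + t_ℓ)`, whose real part on `ℂ` is `v`. -/
def vpoly (k : ℕ) (t : Fin k → ℝ) : ℝ[X] := -∏ l : Fin k, ((X - C (t l)) * (X + C (t l)))

/-- The linear map `(x, y) ↦ x + i y_j`. -/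
def zeta {N : ℕ} (j : Fin N) : Pt N →L[ℝ] ℂ :=
  (ContinuousLinearMap.fst ℝ ℝ (Fin N → ℝ)).smulRight (1 : ℂ) +
    ((ContinuousLinearMap.proj j).comp
      (ContinuousLinearMap.snd ℝ ℝ (Fin N → ℝ))).smulRight Complex.I

lemma zeta_apply {N : ℕ} (j : Fin N) (p : Pt N) :
    zeta j p = (p.1 : ℂ) + (p.2 j : ℂ) * Complex.I := by
  simp [zeta]

lemma vfun_eq_re_aeval (k : ℕ) (t : Fin k → ℝ) (a s : ℝ) :
    vfun k t a s = (aeval ((a : ℂ) + (s : ℂ) * Complex.I) (vpoly k t)).re := by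
  simp [vfun, vpoly, map_prod]

lemma norm_aeval_le (g : ℝ[X]) {n : ℕ} (hn : g.natDegree ≤ n) :
    ∃ C : ℝ, 0 ≤ C ∧ ∀ z : ℂ, ‖aeval z g‖ ≤ C * (1 + ‖z‖) ^ n := by
  refine ⟨∑ i ∈ Finset.range (n + 1), ‖g.coeff i‖, by positivity, fun z => ?_⟩
  rw [aeval_eq_sum_range' (Nat.lt_succ_of_le hn), Finset.sum_mul]
  refine (norm_sum_le _ _).trans (Finset.sum_le_sum fun i hi => ?_)
  rw [norm_smul, norm_pow]
  have h1 : ‖z‖ ^ i ≤ (1 + ‖z‖) ^ i := by gcongr; linarith [norm_nonneg z]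
  have h2 : (1 + ‖z‖) ^ i ≤ (1 + ‖z‖) ^ n :=
    pow_le_pow_right₀ (by linarith [norm_nonneg z]) (by simpa [Nat.lt_succ_iff] using hi)
  exact mul_le_mul_of_nonneg_left (h1.trans h2) (norm_nonneg _)

lemma norm_aeval_le_of_abs_im_le (g : ℝ[X]) {n : ℕ} (hn : g.natDegree ≤ n) {S : ℝ} (hS : 0 ≤ S) :
    ∃ C : ℝ, 0 ≤ C ∧ ∀ z : ℂ, |z.im| ≤ S → ‖aeval z g‖ ≤ C * (1 + |z.re|) ^ n := by
  obtain ⟨C, hC, h⟩ := norm_aeval_le g hn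
  refine ⟨C * (1 + S) ^ n, by positivity, fun z hz => (h z).trans ?_⟩
  rw [mul_assoc, ← mul_pow]
  have := Complex.norm_le_abs_re_add_abs_im z
  gcongr
  nlinarith [abs_nonneg z.re]

lemma norm_aeval_sub_aeval_re_le (g : ℝ[X]) (z : ℂ) {B : ℝ}
    (hB : ∀ w : ℂ, w.re = z.re → |w.im| ≤ |z.im| → ‖aeval w (derivative g)‖ ≤ B) :
    ‖aeval z g - aeval (z.re : ℂ) g‖ ≤ B * |z.im| := by
  have hcv : Convex ℝ {w : ℂ | w.re = z.re ∧ |w.im| ≤ |z.im|} := by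
    have h1 : Convex ℝ {w : ℂ | w.re = z.re} :=
      convex_hyperplane (f := fun w : ℂ => w.re)
        ⟨fun _ _ => Complex.add_re _ _, fun _ _ => by simp⟩ _
    have h2 : Convex ℝ {w : ℂ | |w.im| ≤ |z.im|} := by
      have h : {w : ℂ | |w.im| ≤ |z.im|} = Complex.imLm ⁻¹' Set.Icc (-|z.im|) |z.im| := by
        ext w
        simp [abs_le]
      rw [h]
      exact (convex_Icc _ _).linear_preimage Complex.imLm
    exact h1.inter h2
  have := hcv.norm_image_sub_le_of_norm_hasDerivWithin_le (𝕜 := ℂ)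
    (f := fun w => aeval w g) (f' := fun w => aeval w (derivative g)) (C := B)
    (fun w _ => (g.hasDerivAt_aeval w).hasDerivWithinAt) (fun w hw => hB w hw.1 hw.2)
    (x := (z.re : ℂ)) (y := z) (by simp) (by simp)
  have hz : z - (z.re : ℂ) = (z.im : ℂ) * Complex.I := by
    apply Complex.ext <;> simp
  rw [hz] at this
  simpa using this

lemma natDegree_vpoly (k : ℕ) (hk : 1 ≤ k) (t : Fin k → ℝ) :
    (vpoly k t + X ^ (2 * k)).natDegree ≤ 2 * k - 1 ∧ (vpoly k t).natDegree = 2 * k := by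
  have hm : ∀ l, ((X - C (t l)) * (X + C (t l))).Monic :=
    fun l => (monic_X_sub_C _).mul (monic_X_add_C _)
  set q : ℝ[X] := ∏ l : Fin k, ((X - C (t l)) * (X + C (t l))) with hq
  have hqm : q.Monic := monic_prod_of_monic _ _ fun l _ => hm l
  have hqd : q.natDegree = 2 * k := by
    rw [hq, natDegree_prod_of_monic _ _ fun l _ => hm l]
    have : ∀ l, ((X - C (t l)) * (X + C (t l))).natDegree = 2 := fun l => by
      rw [(monic_X_sub_C _).natDegree_mul (monic_X_add_C _)]; simp
    rw [Finset.sum_congr rfl fun l _ => this l]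
    simp [mul_comm]
  have hv : vpoly k t = -q := rfl
  refine ⟨?_, by rw [hv, natDegree_neg, hqd]⟩
  have hlt : (X ^ (2 * k) - q).degree < (X ^ (2 * k) : ℝ[X]).degree := by
    apply degree_sub_lt_left
    · rw [degree_X_pow, degree_eq_natDegree hqm.ne_zero, hqd]
    · exact (monic_X_pow _).ne_zero
    · rw [(monic_X_pow _).leadingCoeff, hqm.leadingCoeff]
  rw [degree_X_pow] at hlt
  rw [hv, neg_add_eq_sub]
  by_cases h0 : X ^ (2 * k) - q = 0
  · simp [h0]
  · have := (natDegree_lt_iff_degree_lt h0).2 hlt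
    omega

/-- In a horizontal strip, `Re f(z) ≤ -X^{2k} + O(X^{2k-1})` and `f'' = O(X^{2k-1})`,
where `X = 1 + |Re z|`. -/
lemma vpoly_strip_bounds (k : ℕ) (hk : 1 ≤ k) (t : Fin k → ℝ) {S : ℝ} (hS : 0 ≤ S) :
    ∃ C : ℝ, 0 < C ∧ ∀ z : ℂ, |z.im| ≤ S →
      (aeval z (vpoly k t)).re ≤ (1 + |z.re|) ^ (2 * k - 1) * (C - (1 + |z.re|)) ∧
      ‖aeval z (derivative (derivative (vpoly k t)))‖ ≤ C * (1 + |z.re|) ^ (2 * k - 1) := by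
  obtain ⟨hr, hd⟩ := natDegree_vpoly k hk t
  have hd1 : (derivative (vpoly k t)).natDegree ≤ 2 * k - 1 :=
    (natDegree_derivative_le _).trans (by omega)
  have hd2 : (derivative (derivative (vpoly k t))).natDegree ≤ 2 * k - 1 :=
    (natDegree_derivative_le _).trans (by omega)
  obtain ⟨C₀, hC₀, h₀⟩ := norm_aeval_le_of_abs_im_le _ hr hS
  obtain ⟨C₁, hC₁, h₁⟩ := norm_aeval_le_of_abs_im_le _ hd1 hS
  obtain ⟨C₂, hC₂, h₂⟩ := norm_aeval_le_of_abs_im_le _ hd2 hS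
  refine ⟨C₀ + C₁ * S + C₂ + 2 * k, by positivity, fun z hz => ⟨?_, ?_⟩⟩
  · have hX : 1 ≤ 1 + |z.re| := by linarith [abs_nonneg z.re]
    have e1 := norm_aeval_sub_aeval_re_le (vpoly k t) z
      (B := C₁ * (1 + |z.re|) ^ (2 * k - 1))
      fun w hw hw' => by simpa [hw] using h₁ w (hw'.trans hz)
    have e2 : ‖aeval (z.re : ℂ) (vpoly k t + X ^ (2 * k))‖ ≤ C₀ * (1 + |z.re|) ^ (2 * k - 1) := by
      simpa using h₀ (z.re : ℂ) (by simpa using hS)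
    have e3 : (1 + |z.re|) ^ (2 * k) - 2 * k * (1 + |z.re|) ^ (2 * k - 1) ≤ z.re ^ (2 * k) := by
      rw [← (even_two_mul k).pow_abs z.re]
      have hX0 : (0 : ℝ) < 1 + |z.re| := by linarith
      have hb := one_add_mul_le_pow (a := -(1 / (1 + |z.re|))) (by
        have : 1 / (1 + |z.re|) ≤ 1 := by rw [div_le_one hX0]; exact hX
        linarith) (2 * k)
      have hm := mul_le_mul_of_nonneg_right hb (pow_nonneg hX0.le (2 * k))
      rw [← mul_pow] at hm
      have hq : (1 + -(1 / (1 + |z.re|))) * (1 + |z.re|) = |z.re| := by field_simp; ring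
      rw [hq] at hm
      refine le_trans (le_of_eq ?_) hm
      have hp : (1 + |z.re|) ^ (2 * k) = (1 + |z.re|) ^ (2 * k - 1) * (1 + |z.re|) := by
        rw [← pow_succ]; congr 1; omega
      rw [hp]
      field_simp
      push_cast
      ring
    have e1' := (Complex.re_le_norm _).trans e1
    have e2' := (Complex.re_le_norm _).trans e2
    have hre : ((z.re : ℂ) ^ (2 * k)).re = z.re ^ (2 * k) := by
      rw [← Complex.ofReal_pow, Complex.ofReal_re]
    rw [map_add, map_pow, aeval_X, Complex.add_re, hre] at e2'
    rw [Complex.sub_re] at e1'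
    have hp : (1 + |z.re|) ^ (2 * k) = (1 + |z.re|) ^ (2 * k - 1) * (1 + |z.re|) := by
      rw [← pow_succ]; congr 1; omega
    have hpos : 0 ≤ (1 + |z.re|) ^ (2 * k - 1) := by positivity
    have e4 : C₁ * (1 + |z.re|) ^ (2 * k - 1) * |z.im| ≤ C₁ * (1 + |z.re|) ^ (2 * k - 1) * S := by
      gcongr
    nlinarith [mul_nonneg hC₂ hpos]
  · refine (h₂ z hz).trans ?_
    gcongr
    have : 0 ≤ C₁ * S := by positivity
    have : (0 : ℝ) ≤ 2 * k := by positivity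
    linarith

lemma hasFDerivAt_re_aeval_zeta {N : ℕ} (g : ℝ[X]) (c : ℂ) (j : Fin N) (p : Pt N) :
    ∃ L : Pt N →L[ℝ] ℝ, HasFDerivAt (fun q => (aeval (zeta j q) g * c).re) L p ∧
      ∀ w, L w = (aeval (zeta j p) (derivative g) * zeta j w * c).re := by
  have h := ((g.hasDerivAt_aeval (zeta j p)).mul_const c).hasFDerivAt.restrictScalars ℝ
  have h' := Complex.reCLM.hasFDerivAt.comp p (h.comp p (zeta j).hasFDerivAt)
  refine ⟨_, h', fun w => ?_⟩
  simp [mul_comm, mul_left_comm]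

lemma hasFDerivAt_ueps (N k : ℕ) (t : Fin k → ℝ) (ε : ℝ) (p : Pt N) :
    ∃ L : Pt N →L[ℝ] ℝ, HasFDerivAt (ueps N k t ε) L p ∧
      ∀ w, L w = -∑ j, p.2 j * w.2 j +
        ε * ∑ j, (aeval (zeta j p) (derivative (vpoly k t)) * zeta j w).re := by
  choose L hL hLw using fun j : Fin N => hasFDerivAt_re_aeval_zeta (vpoly k t) 1 j p
  have hy : ∀ j : Fin N, HasFDerivAt (fun q : Pt N => q.2 j)
      ((ContinuousLinearMap.proj j).comp (ContinuousLinearMap.snd ℝ ℝ (Fin N → ℝ))) p :=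
    fun j => ((ContinuousLinearMap.proj (R := ℝ) (φ := fun _ : Fin N => ℝ) j).comp
      (ContinuousLinearMap.snd ℝ ℝ (Fin N → ℝ))).hasFDerivAt
  have h1 := ((HasFDerivAt.fun_sum fun j (_ : j ∈ Finset.univ) => (hy j).pow 2).const_sub
    (N : ℝ)).const_mul (1 / 2)
  have h2 := (HasFDerivAt.fun_sum fun j (_ : j ∈ Finset.univ) => hL j).const_mul ε
  have h := h1.add h2
  refine ⟨_, h.congr_of_eventuallyEq (Eventually.of_forall fun q => ?_), fun w => ?_⟩
  · simp [ueps, vfun_eq_re_aeval, zeta_apply]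
  · simp [hLw, Finset.mul_sum, mul_assoc]

lemma fderiv_ueps_apply (N k : ℕ) (t : Fin k → ℝ) (ε : ℝ) (p w : Pt N) :
    fderiv ℝ (ueps N k t ε) p w = -∑ j, p.2 j * w.2 j +
        ε * ∑ j, (aeval (zeta j p) (derivative (vpoly k t)) * zeta j w).re := by
  obtain ⟨L, hL, h⟩ := hasFDerivAt_ueps N k t ε p
  rw [hL.fderiv, h]

lemma continuous_ueps (N k : ℕ) (t : Fin k → ℝ) (ε : ℝ) : Continuous (ueps N k t ε) := by
  refine continuous_iff_continuousAt.2 fun p => ?_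
  obtain ⟨L, hL, -⟩ := hasFDerivAt_ueps N k t ε p
  exact hL.continuousAt

lemma D2_ueps (N k : ℕ) (t : Fin k → ℝ) (ε : ℝ) (v w p : Pt N) :
    D2 (ueps N k t ε) v w p = -∑ j, v.2 j * w.2 j +
        ε * ∑ j, (aeval (zeta j p) (derivative (derivative (vpoly k t))) *
          zeta j v * zeta j w).re := by
  choose L hL hLw using fun j : Fin N =>
    hasFDerivAt_re_aeval_zeta (derivative (vpoly k t)) (zeta j w) j p
  have hy : ∀ j : Fin N, HasFDerivAt (fun q : Pt N => q.2 j)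
      ((ContinuousLinearMap.proj j).comp (ContinuousLinearMap.snd ℝ ℝ (Fin N → ℝ))) p :=
    fun j => ((ContinuousLinearMap.proj (R := ℝ) (φ := fun _ : Fin N => ℝ) j).comp
      (ContinuousLinearMap.snd ℝ ℝ (Fin N → ℝ))).hasFDerivAt
  have h1 := (HasFDerivAt.fun_sum fun j (_ : j ∈ Finset.univ) => (hy j).mul_const (w.2 j)).fun_neg
  have h2 := (HasFDerivAt.fun_sum fun j (_ : j ∈ Finset.univ) => hL j).const_mul ε
  unfold D2
  simp_rw [fderiv_ueps_apply]
  rw [(h1.fun_add h2).fderiv]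
  simp [hLw, mul_comm]

lemma Dx_ueps (N k : ℕ) (t : Fin k → ℝ) (ε : ℝ) (p : Pt N) :
    Dx (ueps N k t ε) p = ε * ∑ j, (aeval (zeta j p) (derivative (vpoly k t))).re := by
  simp [Dx, fderiv_ueps_apply, zeta_apply (p := ((1 : ℝ), (0 : Fin N → ℝ)))]

lemma Dy_ueps (N k : ℕ) (t : Fin k → ℝ) (ε : ℝ) (j : Fin N) (p : Pt N) :
    Dy (ueps N k t ε) j p =
      -p.2 j - ε * (aeval (zeta j p) (derivative (vpoly k t))).im := by
  have : ∀ i : Fin N, (aeval (zeta i p) (derivative (vpoly k t)) *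
      zeta i ((0 : ℝ), Pi.single j (1 : ℝ))).re =
      if i = j then -(aeval (zeta i p) (derivative (vpoly k t))).im else 0 := by
    intro i
    by_cases h : i = j
    · subst h; simp [zeta_apply (p := ((0 : ℝ), (Pi.single i 1 : Fin N → ℝ)))]
    · simp [zeta_apply (p := ((0 : ℝ), (Pi.single j 1 : Fin N → ℝ))), h]
  simp [Dy, fderiv_ueps_apply, this, Pi.single_apply]
  ring

lemma D2_ueps_yy (N k : ℕ) (t : Fin k → ℝ) (ε : ℝ) (j : Fin N) (p : Pt N) :
    D2 (ueps N k t ε) (0, Pi.single j 1) (0, Pi.single j 1) p =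
      -1 - ε * (aeval (zeta j p) (derivative (derivative (vpoly k t)))).re := by
  have : ∀ i : Fin N, (aeval (zeta i p) (derivative (derivative (vpoly k t))) *
      zeta i ((0 : ℝ), Pi.single j (1 : ℝ)) * zeta i ((0 : ℝ), Pi.single j (1 : ℝ))).re =
      if i = j then -(aeval (zeta i p) (derivative (derivative (vpoly k t)))).re else 0 := by
    intro i
    by_cases h : i = j
    · subst h; simp [zeta_apply (p := ((0 : ℝ), (Pi.single i 1 : Fin N → ℝ))), mul_assoc]
    · simp [zeta_apply (p := ((0 : ℝ), (Pi.single j 1 : Fin N → ℝ))), h]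
  simp [D2_ueps, this, Pi.single_apply]
  ring

lemma D2_ueps_xy (N k : ℕ) (t : Fin k → ℝ) (ε : ℝ) (j : Fin N) (p : Pt N) :
    D2 (ueps N k t ε) (1, 0) (0, Pi.single j 1) p =
      -(ε * (aeval (zeta j p) (derivative (derivative (vpoly k t)))).im) := by
  have : ∀ i : Fin N, (aeval (zeta i p) (derivative (derivative (vpoly k t))) *
      zeta i ((1 : ℝ), (0 : Fin N → ℝ)) * zeta i ((0 : ℝ), Pi.single j (1 : ℝ))).re =
      if i = j then -(aeval (zeta i p) (derivative (derivative (vpoly k t)))).im else 0 := by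
    intro i
    by_cases h : i = j
    · subst h
      simp [zeta_apply (p := ((0 : ℝ), (Pi.single i 1 : Fin N → ℝ))),
        zeta_apply (p := ((1 : ℝ), (0 : Fin N → ℝ)))]
    · simp [zeta_apply (p := ((0 : ℝ), (Pi.single j 1 : Fin N → ℝ))), h]
  simp [D2_ueps, this]

lemma D2_ueps_xx (N k : ℕ) (t : Fin k → ℝ) (ε : ℝ) (p : Pt N) :
    D2 (ueps N k t ε) (1, 0) (1, 0) p =
      ε * ∑ j, (aeval (zeta j p) (derivative (derivative (vpoly k t)))).re := by
  simp [D2_ueps, zeta_apply (p := ((1 : ℝ), (0 : Fin N → ℝ)))]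

/-- A critical point criterion: if `ε f''` is small on the vertical segments below the points
`x + i y_j`, the gradient only vanishes at points of the `x`-axis that are critical for `f`. -/
lemma gradSq_ueps_pos {N k : ℕ} (hN : 2 ≤ N) {t : Fin k → ℝ} {ε : ℝ} (hε : 0 < ε) {p : Pt N}
    (hu : ueps N k t ε p = 0)
    (hsmall : ∀ j, ∀ w : ℂ, w.re = p.1 → |w.im| ≤ |p.2 j| →
      ε * ‖aeval w (derivative (derivative (vpoly k t)))‖ ≤ 1 / 8)
    (hcrit : ∀ x : ℝ, eval x (derivative (vpoly k t)) = 0 → ε * eval x (vpoly k t) ≠ -(1 / 2)) :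
    0 < gradSq (ueps N k t ε) p := by
  have hreal : ∀ (g : ℝ[X]) (x : ℝ), aeval (x : ℂ) g = ((eval x g : ℝ) : ℂ) := fun g x => by
    simpa using aeval_algebraMap_apply ℂ x g
  have hnn : 0 ≤ ∑ j : Fin N, (Dy (ueps N k t ε) j p) ^ 2 := by positivity
  by_contra hcon
  unfold gradSq at hcon
  have hx : Dx (ueps N k t ε) p = 0 := by
    have := sq_nonneg (Dx (ueps N k t ε) p)
    exact pow_eq_zero_iff two_ne_zero |>.1 (by linarith)
  have hsum : ∑ j : Fin N, (Dy (ueps N k t ε) j p) ^ 2 = 0 := by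
    have := sq_nonneg (Dx (ueps N k t ε) p)
    linarith
  have hy0 : ∀ j, p.2 j = 0 := by
    intro j
    have hj : Dy (ueps N k t ε) j p = 0 := by
      have := (Finset.sum_eq_zero_iff_of_nonneg fun i _ => sq_nonneg _).1 hsum j (Finset.mem_univ _)
      exact pow_eq_zero_iff two_ne_zero |>.1 this
    rw [Dy_ueps] at hj
    have him : (zeta j p).im = p.2 j := by simp [zeta_apply]
    have hre : (zeta j p).re = p.1 := by simp [zeta_apply]
    have hb := norm_aeval_sub_aeval_re_le (derivative (vpoly k t)) (zeta j p) (B := 1 / 8 / ε)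
      fun w hw hw' => by
        rw [le_div_iff₀ hε, mul_comm]
        exact hsmall j w (hw.trans hre) (by rwa [him] at hw')
    have hb' := (Complex.abs_im_le_norm _).trans hb
    rw [Complex.sub_im, hreal, Complex.ofReal_im, sub_zero, him] at hb'
    have h3 : ε * |(aeval (zeta j p) (derivative (vpoly k t))).im| ≤ 1 / 8 * |p.2 j| := by
      calc _ ≤ ε * (1 / 8 / ε * |p.2 j|) := by gcongr
        _ = _ := by field_simp
    have h4 : |p.2 j| = ε * |(aeval (zeta j p) (derivative (vpoly k t))).im| := by
      rw [show p.2 j = -(ε * (aeval (zeta j p) (derivative (vpoly k t))).im) by linarith,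
        abs_neg, abs_mul, abs_of_pos hε]
    exact abs_eq_zero.1 (by linarith [abs_nonneg (p.2 j)])
  have hz : ∀ j, zeta j p = (p.1 : ℂ) := fun j => by simp [zeta_apply, hy0 j]
  have hN0 : (N : ℝ) ≠ 0 := by positivity
  refine hcrit p.1 ?_ ?_
  · rw [Dx_ueps] at hx
    simpa [hz, hreal, hε.ne', hN0] using hx
  · have : ueps N k t ε p = N * (1 / 2 + ε * eval p.1 (vpoly k t)) := by
      simp [ueps, vfun_eq_re_aeval, hy0, hreal]
      ring
    rw [this] at hu
    have := (mul_eq_zero.1 hu).resolve_left hN0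
    linarith

lemma Km_ueps_pos {N k : ℕ} (hN : 2 ≤ N) {t : Fin k → ℝ} {ε : ℝ} (hε : 0 < ε) {p : Pt N}
    (hg : 0 < gradSq (ueps N k t ε) p)
    (hsmall : ∀ j, ε * ‖aeval (zeta j p) (derivative (derivative (vpoly k t)))‖ ≤ 1 / 8) :
    0 < Km N (ueps N k t ε) p := by
  have hN2 : (2 : ℝ) ≤ N := by exact_mod_cast hN
  have hre : ∀ j, |ε * (aeval (zeta j p) (derivative (derivative (vpoly k t)))).re| ≤ 1 / 8 :=
    fun j => by
      rw [abs_mul, abs_of_pos hε]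
      exact (mul_le_mul_of_nonneg_left (Complex.abs_re_le_norm _) hε.le).trans (hsmall j)
  have him : ∀ j, |ε * (aeval (zeta j p) (derivative (derivative (vpoly k t)))).im| ≤ 1 / 8 :=
    fun j => by
      rw [abs_mul, abs_of_pos hε]
      exact (mul_le_mul_of_nonneg_left (Complex.abs_im_le_norm _) hε.le).trans (hsmall j)
  have hyy : ∀ j, D2 (ueps N k t ε) (0, Pi.single j 1) (0, Pi.single j 1) p ≤ -(7 / 8) := fun j => by
    rw [D2_ueps_yy]
    linarith [(abs_le.1 (hre j)).1]
  have hxy : ∀ j, |D2 (ueps N k t ε) (1, 0) (0, Pi.single j 1) p| ≤ 1 / 8 := fun j => by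
    rw [D2_ueps_xy, abs_neg]
    exact him j
  have hxx : D2 (ueps N k t ε) (1, 0) (1, 0) p ≤ N / 8 := by
    rw [D2_ueps_xx, Finset.mul_sum]
    calc _ ≤ ∑ j : Fin N, (1 / 8 : ℝ) := Finset.sum_le_sum fun j _ => (abs_le.1 (hre j)).2
      _ = _ := by simp; ring
  unfold Km
  unfold gradSq at hg ⊢
  set a := Dx (ueps N k t ε) p
  set b := fun j => Dy (ueps N k t ε) j p
  have hcoef : 0 < 1 / (N * Real.sqrt (a ^ 2 + ∑ j, (b j) ^ 2) ^ 3) := by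
    have := Real.sqrt_pos.2 hg
    positivity
  rw [neg_mul, neg_pos]
  refine mul_neg_of_pos_of_neg hcoef ?_
  have s1 : ∀ j, a ^ 2 * D2 (ueps N k t ε) (0, Pi.single j 1) (0, Pi.single j 1) p
          - 2 * a * b j * D2 (ueps N k t ε) (1, 0) (0, Pi.single j 1) p
          + (b j) ^ 2 * D2 (ueps N k t ε) (1, 0) (1, 0) p ≤
        -(3 / 4) * a ^ 2 + (1 / 8 + N / 8) * (b j) ^ 2 := fun j => by
    have c1 := mul_le_mul_of_nonneg_left (hyy j) (sq_nonneg a)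
    have c2 := mul_le_mul_of_nonneg_left hxx (sq_nonneg (b j))
    have c3 : -(2 * a * b j * D2 (ueps N k t ε) (1, 0) (0, Pi.single j 1) p) ≤
        1 / 8 * (a ^ 2 + b j ^ 2) := by
      obtain ⟨d1, d2⟩ := abs_le.1 (hxy j)
      nlinarith [mul_nonneg (sub_nonneg.2 d2) (sq_nonneg (a - b j)),
        mul_nonneg (neg_le_iff_add_nonneg.1 d1) (sq_nonneg (a + b j))]
    linarith
  have s2 : ∀ j, (b j) ^ 2 *
      ∑ l ∈ Finset.univ.erase j, D2 (ueps N k t ε) (0, Pi.single l 1) (0, Pi.single l 1) p ≤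
        -(7 / 8) * (N - 1) * (b j) ^ 2 := fun j => by
    have : ∑ l ∈ Finset.univ.erase j,
        D2 (ueps N k t ε) (0, Pi.single l 1) (0, Pi.single l 1) p ≤ -(7 / 8) * (N - 1) := by
      refine (Finset.sum_le_sum fun l _ => hyy l).trans (le_of_eq ?_)
      rw [Finset.sum_const, Finset.card_erase_of_mem (Finset.mem_univ _), Finset.card_univ,
        Fintype.card_fin, nsmul_eq_mul, Nat.cast_sub (by omega)]
      push_cast
      ring
    nlinarith [sq_nonneg (b j)]
  have t1 := Finset.sum_le_sum fun j (_ : j ∈ (Finset.univ : Finset (Fin N))) => s1 j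
  have t2 := Finset.sum_le_sum fun j (_ : j ∈ (Finset.univ : Finset (Fin N))) => s2 j
  refine (add_le_add t1 t2).trans_lt ?_
  simp only [Finset.sum_add_distrib, ← Finset.mul_sum, Finset.sum_const, Finset.card_univ,
    Fintype.card_fin, nsmul_eq_mul]
  have hB : 0 ≤ ∑ j, (b j) ^ 2 := by positivity
  have hg' : 0 < a ^ 2 + ∑ j, (b j) ^ 2 := hg
  nlinarith [mul_nonneg (sub_nonneg.2 hN2) (sq_nonneg a), mul_nonneg (sub_nonneg.2 hN2) hB]

lemma frontier_connectedComponentIn_pos {E : Type*} [TopologicalSpace E]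
    [LocallyConnectedSpace E] {u : E → ℝ} (hu : Continuous u) {x p : E}
    (hp : p ∈ frontier (connectedComponentIn {q | 0 < u q} x)) : u p = 0 := by
  have hopen : IsOpen {q | 0 < u q} := isOpen_lt continuous_const hu
  have hcl := frontier_subset_closure hp
  have hge : 0 ≤ u p := by
    have h : closure {q | 0 < u q} ⊆ {q | 0 ≤ u q} :=
      closure_minimal (fun q (hq : 0 < u q) => show 0 ≤ u q from hq.le) (isClosed_le continuous_const hu)
    exact h (closure_mono (connectedComponentIn_subset _ _) hcl)
  refine le_antisymm (not_lt.1 fun hpos => ?_) hge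
  obtain ⟨q, hq1, hq2⟩ := mem_closure_iff.1 hcl _ (hopen.connectedComponentIn (x := p))
    (mem_connectedComponentIn hpos)
  have hmem : p ∈ connectedComponentIn {q | 0 < u q} x := by
    rw [connectedComponentIn_eq hq2, ← connectedComponentIn_eq hq1]
    exact mem_connectedComponentIn hpos
  rw [(hopen.connectedComponentIn (x := x)).frontier_eq] at hp
  exact hp.2 hmem

lemma closure_OmT_subset {N k : ℕ} {t : Fin k → ℝ} {ε : ℝ} (hN : 0 < N)
    (hneg : ∀ p : Pt N, ∑ j, (p.2 j) ^ 2 = 2 * N → ueps N k t ε p ≤ 0) :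
    closure (OmT N k t ε) ⊆ {p | ∑ j, (p.2 j) ^ 2 ≤ 2 * N} := by
  have hN' : (0 : ℝ) < N := by exact_mod_cast hN
  have hc : Continuous fun p : Pt N => ∑ j, (p.2 j) ^ 2 := by fun_prop
  refine closure_minimal ?_ (isClosed_le hc continuous_const)
  by_cases h0 : (0 : Pt N) ∈ {p : Pt N | 0 < ueps N k t ε p}
  · have := isPreconnected_connectedComponentIn (x := (0 : Pt N))
      (F := {p : Pt N | 0 < ueps N k t ε p}) |>.subset_left_of_subset_union
      (isOpen_lt hc continuous_const : IsOpen {p : Pt N | ∑ j, (p.2 j) ^ 2 < 2 * (N : ℝ)})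
      (isOpen_lt continuous_const hc : IsOpen {p : Pt N | 2 * (N : ℝ) < ∑ j, (p.2 j) ^ 2})
      (Set.disjoint_left.2 fun p (h1 : ∑ j, (p.2 j) ^ 2 < 2 * (N : ℝ))
        (h2 : 2 * (N : ℝ) < ∑ j, (p.2 j) ^ 2) => lt_asymm h1 h2)
      (fun p hp => by
        have hmem : p ∈ {p : Pt N | 0 < ueps N k t ε p} := connectedComponentIn_subset _ _ hp
        have hpos : 0 < ueps N k t ε p := hmem
        exact lt_or_gt_of_ne fun he => (hneg p he).not_gt hpos)
      ⟨0, mem_connectedComponentIn h0, by simpa using hN'⟩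
    exact fun p hp => le_of_lt (show ∑ j, (p.2 j) ^ 2 < 2 * (N : ℝ) from this hp)
  · rw [OmT, connectedComponentIn_eq_empty h0]
    exact empty_subset _

lemma exists_critical_value_bound (g : ℝ[X]) (hg : 0 < g.natDegree) :
    ∃ M : ℝ, 0 < M ∧ ∀ x, eval x (derivative g) = 0 → |eval x g| ≤ M := by
  have hd : derivative g ≠ 0 := fun h => by
    have := derivative_eq_zero.1 h
    omega
  refine ⟨1 + ∑ x ∈ (derivative g).roots.toFinset, |eval x g|, by positivity, fun x hx => ?_⟩
  have hmem : x ∈ (derivative g).roots.toFinset := by simp [hd, hx]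
  have := Finset.single_le_sum (f := fun x => |eval x g|) (fun _ _ => abs_nonneg _) hmem
  linarith

end LevelSetCurvature

open LevelSetCurvature Polynomial in
theorem statement16 (N : ℕ) (hN : 2 ≤ N) (k : ℕ) (hk : 1 ≤ k)
    (t : Fin k → ℝ) (ht : StrictMono t) (htpos : ∀ i, 0 < t i) :
    ∃ ε₀ > (0:ℝ), ∀ ε ∈ Ioo (0:ℝ) ε₀, ∀ p ∈ frontier (OmT N k t ε),
      fderiv ℝ (ueps N k t ε) p ≠ 0 ∧ 0 < Km N (ueps N k t ε) p := by
  have hN2 : (2 : ℝ) ≤ N := by exact_mod_cast hN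
  obtain ⟨C, hC, hstrip⟩ := vpoly_strip_bounds k hk t (S := 2 * N) (by positivity)
  obtain ⟨M, hM, hcrit⟩ := exists_critical_value_bound (vpoly k t)
    (by rw [(natDegree_vpoly k hk t).2]; omega)
  set n := 2 * k - 1 with hn
  refine ⟨min (1 / (2 * M)) (min (1 / (2 * (C ^ n * C))) (1 / (8 * (C * (5 * C) ^ n)))),
    by positivity, fun ε ⟨hε, hlt⟩ p hp => ?_⟩
  obtain ⟨hεM, hlt⟩ := lt_min_iff.1 hlt
  obtain ⟨hεC, hεD⟩ := lt_min_iff.1 hlt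
  rw [lt_div_iff₀ (by positivity)] at hεM hεC hεD
  have habs : ∀ q : Pt N, ∑ j, (q.2 j) ^ 2 ≤ 2 * N → ∀ j, |q.2 j| ≤ 2 * N := fun q hq j => by
    have := Finset.single_le_sum (f := fun j => (q.2 j) ^ 2) (fun _ _ => sq_nonneg _)
      (Finset.mem_univ j)
    exact abs_le_of_sq_le_sq (by nlinarith) (by positivity)
  have hzre : ∀ (q : Pt N) (j), (zeta j q).re = q.1 := fun q j => by simp [zeta_apply]
  have hzim : ∀ (q : Pt N) (j), (zeta j q).im = q.2 j := fun q j => by simp [zeta_apply]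
  have hvle : ∀ q : Pt N, ∑ j, (q.2 j) ^ 2 ≤ 2 * N → ∀ j,
      vfun k t q.1 (q.2 j) ≤ (1 + |q.1|) ^ n * (C - (1 + |q.1|)) := fun q hq j => by
    have := (hstrip (zeta j q) (by rw [hzim]; exact habs q hq j)).1
    rwa [hzre, zeta_apply, ← vfun_eq_re_aeval] at this
  have hneg : ∀ q : Pt N, ∑ j, (q.2 j) ^ 2 = 2 * N → ueps N k t ε q ≤ 0 := fun q hq => by
    have hv : ∀ j, vfun k t q.1 (q.2 j) ≤ C ^ n * C := fun j => by
      refine (hvle q hq.le j).trans ?_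
      have hX : 0 < 1 + |q.1| := by positivity
      rcases le_total (1 + |q.1|) C with h | h
      · exact mul_le_mul (pow_le_pow_left₀ hX.le h n) (by linarith) (by linarith) (by positivity)
      · exact (mul_nonpos_of_nonneg_of_nonpos (by positivity) (by linarith)).trans (by positivity)
    have hs : ∑ j, vfun k t q.1 (q.2 j) ≤ N * (C ^ n * C) := by
      refine (Finset.sum_le_sum fun j _ => hv j).trans (le_of_eq ?_)
      simp
    have h1 := mul_le_mul_of_nonneg_left hs hε.le
    rw [ueps, hq]
    nlinarith
  have hu : ueps N k t ε p = 0 :=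
    frontier_connectedComponentIn_pos (continuous_ueps N k t ε) hp
  have hy : ∑ j, (p.2 j) ^ 2 ≤ 2 * N :=
    closure_OmT_subset (by omega) hneg (frontier_subset_closure hp)
  have hX : 0 < 1 + |p.1| := by positivity
  have hgrowth : ε * ((1 + |p.1|) ^ n * ((1 + |p.1|) - C)) ≤ 1 / 2 := by
    have hs : ∑ j, vfun k t p.1 (p.2 j) ≤ N * ((1 + |p.1|) ^ n * (C - (1 + |p.1|))) := by
      refine (Finset.sum_le_sum fun j _ => hvle p hy j).trans (le_of_eq ?_)
      simp
    have h1 := mul_le_mul_of_nonneg_left hs hε.le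
    have hy0 : 0 ≤ ∑ j, (p.2 j) ^ 2 := by positivity
    rw [ueps] at hu
    have h2 : (N : ℝ) * (ε * ((1 + |p.1|) ^ n * ((1 + |p.1|) - C))) ≤ N * (1 / 2) := by linarith
    exact le_of_mul_le_mul_left h2 (by linarith)
  have hsmallX : ε * (C * (1 + |p.1|) ^ n) ≤ 1 / 8 := by
    rcases le_total (1 + |p.1|) (5 * C) with h | h
    · calc ε * (C * (1 + |p.1|) ^ n) ≤ ε * (C * (5 * C) ^ n) := by gcongr
        _ ≤ 1 / 8 := by linarith
    · have : ε * (1 + |p.1|) ^ n * (4 * C) ≤ ε * (1 + |p.1|) ^ n * ((1 + |p.1|) - C) :=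
        mul_le_mul_of_nonneg_left (by linarith) (by positivity)
      linarith
  have hsmall : ∀ w : ℂ, w.re = p.1 → |w.im| ≤ 2 * N →
      ε * ‖aeval w (derivative (derivative (vpoly k t)))‖ ≤ 1 / 8 := fun w hw hw' => by
    have := (hstrip w hw').2
    rw [hw] at this
    exact (mul_le_mul_of_nonneg_left this hε.le).trans hsmallX
  have hg : 0 < gradSq (ueps N k t ε) p := by
    refine gradSq_ueps_pos hN hε hu
      (fun j w hw hw' => hsmall w hw (hw'.trans (habs p hy j))) fun x hx he => ?_
    have h1 := (abs_le.1 (hcrit x hx)).1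
    have h2 := mul_le_mul_of_nonneg_left h1 hε.le
    linarith
  refine ⟨fun h => ?_, Km_ueps_pos hN hε hg fun j => hsmall _ (hzre p j) ?_⟩
  · simp [gradSq, Dx, Dy, h] at hg
  · rw [hzim]
    exact habs p hy j
end
end
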